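/- arXiv:math/0701840 — 14 statements merged into one kernel-verified Lean document; each statement's English description precedes it below -/
import Mathlib

section
/- Let φ₁(z,ζ) = (λ₁ ζ^{s₁} z + P₁(ζ), ζ^{k₁}) and φ₂(z,ζ) = (λ₂ ζ^{s₂} z + P₂(ζ), ζ^{k₂}) be two polynomial germs in pure normal form, with data (k₁, s₁, j₁, λ₁, P₁) and (k₂, s₂, j₂, λ₂, P₂). Then for all (z,ζ) ∈ ℂ² one has φ₁ ∘ φ₂ (z,ζ) = (λ₁λ₂ ζ^{s₁k₂+s₂} z + P₁(ζ^{k₂}) + λ₁ ζ^{s₁k₂} P₂(ζ), ζ^{k₁k₂}), and this composition is again a polynomial germ in pure normal form with invariants k = k₁k₂, j = j₁k₂ and s = s₁k₂ + s₂ (i.e., setting P(ζ) := P₁(ζ^{k₂}) + λ₁ ζ^{s₁k₂} P₂(ζ), one has: P has lowest-degree term ζ^{j₁k₂} with coefficient 1, 0 < j₁k₂ < k₁k₂, j₁k₂ ≤ s₁k₂+s₂, all exponents of nonzero coefficients of P are ≤ s₁k₂+s₂, and gcd({k₁k₂} ∪ {m : the coefficient of ζ^m in P is nonzero}) = 1).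 -/
open Polynomial

/-- The polynomial germ `(z,ζ) ↦ (λ ζ^s z + P(ζ), ζ^k)` associated to the data `(k,s,λ,P)`. -/
noncomputable def germ (k s : ℕ) (lam : ℂ) (P : Polynomial ℂ) : ℂ × ℂ → ℂ × ℂ :=
  fun p => (lam * p.2 ^ s * p.1 + P.eval p.2, p.2 ^ k)

/-- The germ `(z,ζ) ↦ (λ ζ^s z + P(ζ), ζ^k)` is a polynomial germ in pure normal form with
invariants `(k,s,j)`: `k ≥ 2`, `s ≥ 1`, `λ ≠ 0`, `P = Σ_{m=j}^{s} c_m ζ^m` with `0 < j < k`,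
`j ≤ s`, `c_j = 1`, and `gcd({k} ∪ {m : c_m ≠ 0}) = 1`. -/
def IsPureNormalForm (k s j : ℕ) (lam : ℂ) (P : Polynomial ℂ) : Prop :=
  2 ≤ k ∧ 1 ≤ s ∧ 0 < j ∧ j < k ∧ j ≤ s ∧ lam ≠ 0 ∧
    P.coeff j = 1 ∧ (∀ m : ℕ, P.coeff m ≠ 0 → j ≤ m ∧ m ≤ s) ∧
    Nat.gcd k (P.support.gcd id) = 1

theorem germ_comp (k₁ s₁ k₂ s₂ : ℕ) (lam₁ lam₂ : ℂ) (P₁ P₂ : ℂ[X]) :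
    germ k₁ s₁ lam₁ P₁ ∘ germ k₂ s₂ lam₂ P₂ =
      germ (k₁ * k₂) (s₁ * k₂ + s₂) (lam₁ * lam₂)
        (P₁.comp (X ^ k₂) + C lam₁ * X ^ (s₁ * k₂) * P₂) := by
  funext p
  simp only [germ, Function.comp_apply, eval_add, eval_mul, eval_comp, eval_pow, eval_X, eval_C,
    Prod.mk.injEq]
  constructor <;> ring

theorem coeff_comp_X_pow_mul {R : Type*} [CommSemiring R] (P : R[X]) {k : ℕ} (hk : 0 < k) (m : ℕ) :
    (P.comp (X ^ k)).coeff (m * k) = P.coeff m := by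
  rw [← expand_eq_comp_X_pow, coeff_expand_mul hk]

/-- Below or at the degree of the shift, the second summand does not contribute when `Q` has no
constant term. -/
theorem coeff_comp_add_shift_of_le {R : Type*} [CommSemiring R] (P Q : R[X]) (a : R) {k s m : ℕ}
    (hQ : Q.coeff 0 = 0) (hm : m ≤ s * k) :
    (P.comp (X ^ k) + C a * X ^ (s * k) * Q).coeff m = (P.comp (X ^ k)).coeff m := by
  rw [coeff_add, mul_assoc, coeff_C_mul, coeff_X_pow_mul']
  split_ifs with h
  · simp [le_antisymm hm h, hQ]
  · simp

/-- Above the degree of the shift, the first summand does not contribute when `P` has degree at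
most `s`. -/
theorem coeff_comp_add_shift_add {R : Type*} [CommSemiring R] (P Q : R[X]) (a : R) {k s n : ℕ}
    (hk : 0 < k) (hP : ∀ m, P.coeff m ≠ 0 → m ≤ s) (hn : 0 < n) :
    (P.comp (X ^ k) + C a * X ^ (s * k) * Q).coeff (s * k + n) = a * Q.coeff n := by
  have h : (P.comp (X ^ k)).coeff (s * k + n) = 0 := by
    by_cases hd : k ∣ s * k + n
    · obtain ⟨q, hq⟩ := hd
      rw [hq, mul_comm k q, coeff_comp_X_pow_mul P hk]
      by_contra hne
      have := Nat.mul_le_mul_right k (hP q hne)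
      linarith [mul_comm k q]
    · rw [← expand_eq_comp_X_pow, coeff_expand hk, if_neg hd]
  rw [coeff_add, h, zero_add, mul_assoc, coeff_C_mul, add_comm (s * k) n, coeff_X_pow_mul]

theorem gcd_support_eq_one_iff {R : Type*} [Semiring R] (k : ℕ) (P : R[X]) :
    Nat.gcd k (P.support.gcd id) = 1 ↔
      ∀ p : ℕ, p.Prime → p ∣ k → ¬ ∀ m, P.coeff m ≠ 0 → p ∣ m := by
  simp [Nat.eq_one_iff_not_exists_prime_dvd, Nat.dvd_gcd_iff, Finset.dvd_gcd_iff]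

theorem IsPureNormalForm.comp {k₁ s₁ j₁ k₂ s₂ j₂ : ℕ} {lam₁ lam₂ : ℂ} {P₁ P₂ : ℂ[X]}
    (h₁ : IsPureNormalForm k₁ s₁ j₁ lam₁ P₁) (h₂ : IsPureNormalForm k₂ s₂ j₂ lam₂ P₂) :
    IsPureNormalForm (k₁ * k₂) (s₁ * k₂ + s₂) (j₁ * k₂) (lam₁ * lam₂)
      (P₁.comp (X ^ k₂) + C lam₁ * X ^ (s₁ * k₂) * P₂) := by
  obtain ⟨hk₁, hs₁, hj₁, hjk₁, hjs₁, hl₁, hc₁, hsupp₁, hg₁⟩ := h₁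
  obtain ⟨hk₂, hs₂, hj₂, hjk₂, hjs₂, hl₂, hc₂, hsupp₂, hg₂⟩ := h₂
  have hk : 0 < k₂ := by omega
  have hP₂ : P₂.coeff 0 = 0 := by
    by_contra h
    have := (hsupp₂ 0 h).1
    omega
  have low : ∀ m ≤ s₁, (P₁.comp (X ^ k₂) + C lam₁ * X ^ (s₁ * k₂) * P₂).coeff (m * k₂) =
      P₁.coeff m := fun m hm ↦ by
    rw [coeff_comp_add_shift_of_le P₁ P₂ lam₁ hP₂ (Nat.mul_le_mul_right k₂ hm),
      coeff_comp_X_pow_mul P₁ hk]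
  have high : ∀ n, 0 < n →
      (P₁.comp (X ^ k₂) + C lam₁ * X ^ (s₁ * k₂) * P₂).coeff (s₁ * k₂ + n) =
        lam₁ * P₂.coeff n := fun n hn ↦
    coeff_comp_add_shift_add P₁ P₂ lam₁ hk (fun m hm ↦ (hsupp₁ m hm).2) hn
  have hjs : j₁ * k₂ ≤ s₁ * k₂ := Nat.mul_le_mul_right k₂ hjs₁
  refine ⟨by nlinarith, by omega, Nat.mul_pos hj₁ hk, Nat.mul_lt_mul_of_pos_right hjk₁ hk,
    by omega, mul_ne_zero hl₁ hl₂, by rw [low j₁ hjs₁, hc₁], fun m hm ↦ ?_, ?_⟩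
  · rcases le_or_gt m (s₁ * k₂) with hle | hlt
    · rw [coeff_comp_add_shift_of_le P₁ P₂ lam₁ hP₂ hle, ← expand_eq_comp_X_pow,
        coeff_expand hk] at hm
      obtain ⟨hd, hm⟩ := ite_ne_right_iff.mp hm
      have := Nat.mul_le_mul_right k₂ (hsupp₁ _ hm).1
      rw [Nat.div_mul_cancel hd] at this
      omega
    · obtain ⟨n, rfl⟩ := Nat.exists_eq_add_of_lt hlt
      rw [add_assoc, high (n + 1) n.succ_pos] at hm
      have := (hsupp₂ _ (right_ne_zero_of_mul hm)).2
      omega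
  · rw [gcd_support_eq_one_iff] at hg₁ hg₂ ⊢
    intro p hp hpk hdvd
    by_cases hpk₂ : p ∣ k₂
    · refine hg₂ p hp hpk₂ fun m hm ↦ ?_
      have hm0 : 0 < m := hj₂.trans_le (hsupp₂ m hm).1
      have := hdvd (s₁ * k₂ + m) (by rw [high m hm0]; exact mul_ne_zero hl₁ hm)
      exact (Nat.dvd_add_right (hpk₂.mul_left s₁)).mp this
    · refine hg₁ p hp ((hp.dvd_mul.mp hpk).resolve_right hpk₂) fun m hm ↦ ?_
      have := hdvd (m * k₂) (by rwa [low m (hsupp₁ m hm).2])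
      exact (hp.dvd_mul.mp this).resolve_right hpk₂

/-- The composition of two polynomial germs in pure normal form is given by the stated
formula and is again a polynomial germ in pure normal form, with invariants
`k = k₁k₂`, `j = j₁k₂`, `s = s₁k₂ + s₂`. -/
theorem statement0 (k1 s1 j1 k2 s2 j2 : ℕ) (lam1 lam2 : ℂ) (P1 P2 : Polynomial ℂ)
    (h1 : IsPureNormalForm k1 s1 j1 lam1 P1)
    (h2 : IsPureNormalForm k2 s2 j2 lam2 P2) :
    germ k1 s1 lam1 P1 ∘ germ k2 s2 lam2 P2 =
      germ (k1 * k2) (s1 * k2 + s2) (lam1 * lam2)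
        (P1.comp (X ^ k2) + C lam1 * X ^ (s1 * k2) * P2) ∧
    IsPureNormalForm (k1 * k2) (s1 * k2 + s2) (j1 * k2) (lam1 * lam2)
      (P1.comp (X ^ k2) + C lam1 * X ^ (s1 * k2) * P2) :=
  ⟨germ_comp k1 s1 k2 s2 lam1 lam2 P1 P2, h1.comp h2⟩
end

section
/- Let φ₁(z,ζ) = (λ₁ ζ^{s₁} z + P₁(ζ), ζ^{k₁}) and φ₂(z,ζ) = (λ₂ ζ^{s₂} z + P₂(ζ), ζ^{k₂}) be two polynomial germs in pure normal form, of types (m^{(1)}_1, …, m^{(1)}_{t₁}) and (m^{(2)}_1, …, m^{(2)}_{t₂}) respectively. Then the composition φ₁ ∘ φ₂, which is a polynomial germ in pure normal form with k = k₁k₂, j = j₁k₂, s = s₁k₂+s₂ and polynomial part P(ζ) = P₁(ζ^{k₂}) + λ₁ ζ^{s₁k₂} P₂(ζ), has type (k₂ m^{(1)}_1, …, k₂ m^{(1)}_{t₁}, s₁k₂ + m^{(2)}_1, …, s₁k₂ + m^{(2)}_{t₂}); in particular the length of its type is t₁ + t₂. -/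
open Polynomial

/-- Auxiliary recursion computing the type: given the current gcd `i` and the previously
chosen exponent `prev`, choose `m_{α+1} := min {m ∈ S : m > prev, gcd(i,m) < i}` and
continue with `i_{α+1} := gcd(i, m_{α+1})`, stopping as soon as `i = 1`. -/
def typeAux (S : Finset ℕ) : ℕ → ℕ → ℕ → List ℕ
  | 0, _, _ => []
  | fuel + 1, i, prev =>
    if i ≤ 1 then []
    else if h : (S.filter fun m => prev < m ∧ Nat.gcd i m < i).Nonempty then
      let m := (S.filter fun m => prev < m ∧ Nat.gcd i m < i).min' h
      m :: typeAux S fuel (Nat.gcd i m) m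
    else []

/-- The type `(m₁, …, m_t)` of a finite set `S` of positive integers with respect to `k`:
`m₁ := min S`, `i₁ := gcd(k,m₁)`, `m_α := min{m ∈ S : m > m_{α−1}, gcd(i_{α−1},m) < i_{α−1}}`,
`i_α := gcd(i_{α−1}, m_α)`, stopping at the first index `t` with `i_t = 1`. -/
def theType (k : ℕ) (S : Finset ℕ) : List ℕ :=
  if h : S.Nonempty then
    S.min' h :: typeAux S k (Nat.gcd k (S.min' h)) (S.min' h)
  else []

/-- The exponent `m` is the one the recursion `typeAux` picks at the state `(i, prev)`. -/
def IsNextExponent (S : Finset ℕ) (i prev m : ℕ) : Prop :=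
  m ∈ S ∧ prev < m ∧ Nat.gcd i m < i ∧ ∀ m' ∈ S, prev < m' → Nat.gcd i m' < i → m ≤ m'

/-- The invariants of the recursion `typeAux` on a set whose exponents have no divisor in
common with `i`. -/
def IsTypeState (S : Finset ℕ) (i prev : ℕ) : Prop :=
  0 < i ∧ (∀ m ∈ S, m ≤ prev → i ∣ m) ∧ ∀ d, d ∣ i → (∀ m ∈ S, d ∣ m) → d = 1

/-- `T` is the union of `k * A`, with `A` bounded by `s`, and `s * k + B`, with `B` positive. -/
def IsCompositionSupport (T A B : Finset ℕ) (k s : ℕ) : Prop :=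
  (∀ m, m ∈ T ↔ (∃ a ∈ A, m = k * a) ∨ ∃ b ∈ B, m = s * k + b) ∧
    (∀ a ∈ A, a ≤ s) ∧ ∀ b ∈ B, 0 < b

theorem typeAux_of_le_one (S : Finset ℕ) (n : ℕ) {i : ℕ} (prev : ℕ) (hi : i ≤ 1) :
    typeAux S n i prev = [] := by
  cases n <;> simp [typeAux, hi]

theorem typeAux_succ_of_isNextExponent {S : Finset ℕ} {i prev m : ℕ} (n : ℕ) (hi : 1 < i)
    (hm : IsNextExponent S i prev m) :
    typeAux S (n + 1) i prev = m :: typeAux S n (Nat.gcd i m) m := by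
  obtain ⟨hmS, hlt, hgcd, hmin⟩ := hm
  have hmem : m ∈ S.filter fun m => prev < m ∧ Nat.gcd i m < i := by simp [hmS, hlt, hgcd]
  have hne : (S.filter fun m => prev < m ∧ Nat.gcd i m < i).Nonempty := ⟨m, hmem⟩
  have heq : (S.filter fun m => prev < m ∧ Nat.gcd i m < i).min' hne = m := by
    refine le_antisymm (Finset.min'_le _ _ hmem) (Finset.le_min' _ _ _ fun y hy => ?_)
    rw [Finset.mem_filter] at hy
    exact hmin y hy.1 hy.2.1 hy.2.2
  simp only [typeAux]
  rw [if_neg (by omega), dif_pos hne, heq]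

theorem theType_eq_cons {k m : ℕ} {S : Finset ℕ} (hm : m ∈ S) (hmin : ∀ m' ∈ S, m ≤ m') :
    theType k S = m :: typeAux S k (Nat.gcd k m) m := by
  have hne : S.Nonempty := ⟨m, hm⟩
  have heq : S.min' hne = m :=
    le_antisymm (Finset.min'_le _ _ hm) (Finset.le_min' _ _ _ hmin)
  rw [theType, dif_pos hne, heq]

theorem dvd_of_not_gcd_lt {i m : ℕ} (hi : 0 < i) (h : ¬ Nat.gcd i m < i) : i ∣ m :=
  Nat.gcd_eq_left_iff_dvd.1 (le_antisymm (Nat.gcd_le_left m hi) (not_lt.1 h))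

theorem IsTypeState.exists_isNextExponent {S : Finset ℕ} {i prev : ℕ}
    (h : IsTypeState S i prev) (hi : 1 < i) : ∃ m, IsNextExponent S i prev m := by
  obtain ⟨hpos, hdvd, hone⟩ := h
  have hne : (S.filter fun m => prev < m ∧ Nat.gcd i m < i).Nonempty := by
    by_contra hempty
    have hall : ∀ m ∈ S, i ∣ m := fun m hm => by
      rcases le_or_gt m prev with hle | hlt
      · exact hdvd m hm hle
      · exact dvd_of_not_gcd_lt hpos fun hg => hempty ⟨m, by simp [hm, hlt, hg]⟩
    have := hone i dvd_rfl hall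
    omega
  have hmem := Finset.mem_filter.1 (Finset.min'_mem _ hne)
  exact ⟨_, hmem.1, hmem.2.1, hmem.2.2, fun m' hm' hlt hg =>
    Finset.min'_le _ _ (by simp [hm', hlt, hg])⟩

theorem IsTypeState.next {S : Finset ℕ} {i prev m : ℕ}
    (h : IsTypeState S i prev) (hm : IsNextExponent S i prev m) :
    IsTypeState S (Nat.gcd i m) m := by
  obtain ⟨hpos, hdvd, hone⟩ := h
  obtain ⟨-, -, -, hmin⟩ := hm
  refine ⟨Nat.gcd_pos_of_pos_left m hpos, fun m' hm' hle => ?_,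
    fun d hd => hone d (hd.trans (Nat.gcd_dvd_left i m))⟩
  rcases hle.eq_or_lt with rfl | hlt
  · exact Nat.gcd_dvd_right i m'
  refine (Nat.gcd_dvd_left i m).trans ?_
  rcases le_or_gt m' prev with hle' | hlt'
  · exact hdvd m' hm' hle'
  · exact dvd_of_not_gcd_lt hpos fun hg => hlt.not_ge (hmin m' hm' hlt' hg)

theorem isTypeState_gcd_min {S : Finset ℕ} {k m : ℕ} (hk : 0 < k)
    (hmin : ∀ m' ∈ S, m ≤ m') (hgcd : Nat.gcd k (S.gcd id) = 1) :
    IsTypeState S (Nat.gcd k m) m := by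
  refine ⟨Nat.gcd_pos_of_pos_left m hk, fun m' hm' hle => ?_, fun d hd hall => ?_⟩
  · rw [le_antisymm hle (hmin m' hm')]
    exact Nat.gcd_dvd_right k m
  · exact Nat.dvd_one.1 (hgcd ▸ Nat.dvd_gcd (hd.trans (Nat.gcd_dvd_left k m))
      (Finset.dvd_gcd hall))

theorem Nat.gcd_mul_add_of_dvd {i k : ℕ} (hik : i ∣ k) (s m : ℕ) :
    Nat.gcd i (s * k + m) = Nat.gcd i m := by
  obtain ⟨c, rfl⟩ := hik
  rw [show s * (i * c) + m = m + i * (s * c) by ring, Nat.gcd_add_mul_left_right]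

namespace IsCompositionSupport

variable {T A B : Finset ℕ} {k s : ℕ}

theorem typeAux_add (h : IsCompositionSupport T A B k s) (n : ℕ) :
    ∀ {i prev N : ℕ}, i ∣ k → i ≤ n → i ≤ N → IsTypeState B i prev →
      typeAux T N i (s * k + prev) = (typeAux B n i prev).map (fun m => s * k + m) := by
  obtain ⟨hT, hA, -⟩ := h
  induction n with
  | zero =>
    intro i prev N _ hn _ hB
    exact absurd hB.1 (by omega)
  | succ n ih =>
    intro i prev N hik hn hN hB
    rcases le_or_gt i 1 with hi | hi
    · simp [typeAux_of_le_one _ _ _ hi]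
    obtain ⟨m, hm⟩ := hB.exists_isNextExponent hi
    have hlt := hm.2.2.1
    obtain ⟨N, rfl⟩ : ∃ N', N = N' + 1 := ⟨N - 1, by omega⟩
    have hnext : IsNextExponent T i (s * k + prev) (s * k + m) := by
      refine ⟨(hT _).2 (Or.inr ⟨m, hm.1, rfl⟩), by have := hm.2.1; omega, ?_, ?_⟩
      · rwa [Nat.gcd_mul_add_of_dvd hik]
      · intro m' hm' hlt' hg
        rcases (hT m').1 hm' with ⟨a, ha, rfl⟩ | ⟨b, hb, rfl⟩
        · have := Nat.mul_le_mul_left k (hA a ha)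
          rw [mul_comm k s] at this
          omega
        · rw [Nat.gcd_mul_add_of_dvd hik] at hg
          have := hm.2.2.2 b hb (by omega) hg
          omega
    rw [typeAux_succ_of_isNextExponent _ hi hnext, typeAux_succ_of_isNextExponent _ hi hm,
      Nat.gcd_mul_add_of_dvd hik,
      ih ((Nat.gcd_dvd_left i m).trans hik) (by omega) (by omega) (hB.next hm), List.map_cons]

theorem typeAux_mul (h : IsCompositionSupport T A B k s) {b₀ : ℕ} (hb₀ : b₀ ∈ B)
    (hmin : ∀ b ∈ B, b₀ ≤ b) (hb₀k : b₀ < k) (hB : Nat.gcd k (B.gcd id) = 1) (n : ℕ) :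
    ∀ {i prev N : ℕ}, i ≤ n → k * i ≤ N → prev ≤ s → IsTypeState A i prev →
      typeAux T N (k * i) (k * prev) =
        (typeAux A n i prev).map (fun m => k * m) ++
          (theType k B).map (fun m => s * k + m) := by
  obtain ⟨hT, hA, hBpos⟩ := id h
  have hb₀pos := hBpos b₀ hb₀
  have hk : 0 < k := by omega
  induction n with
  | zero =>
    intro i prev N hn _ _ hS
    exact absurd hS.1 (by omega)
  | succ n ih =>
    intro i prev N hn hN hprev hS
    have hprev' : k * prev ≤ s * k := by
      rw [mul_comm s k]
      exact Nat.mul_le_mul_left k hprev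
    have hki := Nat.mul_le_mul_left k hS.1
    obtain ⟨N, rfl⟩ : ∃ N', N = N' + 1 := ⟨N - 1, by omega⟩
    rcases le_or_gt i 1 with hi | hi
    · obtain rfl : i = 1 := le_antisymm hi hS.1
      have hlt : Nat.gcd k b₀ < k := (Nat.gcd_le_right k hb₀pos).trans_lt hb₀k
      have hnext : IsNextExponent T k (k * prev) (s * k + b₀) := by
        refine ⟨(hT _).2 (Or.inr ⟨b₀, hb₀, rfl⟩), by omega, ?_, ?_⟩
        · rwa [Nat.gcd_mul_add_of_dvd dvd_rfl]
        · intro m' hm' hlt' hg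
          rcases (hT m').1 hm' with ⟨a, ha, rfl⟩ | ⟨b, hb, rfl⟩
          · rw [Nat.gcd_mul_right_right] at hg
            omega
          · have := hmin b hb
            omega
      rw [typeAux_of_le_one A _ _ le_rfl, theType_eq_cons hb₀ hmin, mul_one,
        typeAux_succ_of_isNextExponent _ (by omega) hnext, Nat.gcd_mul_add_of_dvd dvd_rfl,
        h.typeAux_add k (Nat.gcd_dvd_left k b₀) hlt.le (by omega)
          (isTypeState_gcd_min hk hmin hB)]
      simp
    · obtain ⟨m, hm⟩ := hS.exists_isNextExponent hi
      have hms := hA m hm.1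
      have hlt : k * Nat.gcd i m < k * i := Nat.mul_lt_mul_of_pos_left hm.2.2.1 hk
      have hnext : IsNextExponent T (k * i) (k * prev) (k * m) := by
        refine ⟨(hT _).2 (Or.inl ⟨m, hm.1, rfl⟩),
          Nat.mul_lt_mul_of_pos_left hm.2.1 hk, ?_, ?_⟩
        · rwa [Nat.gcd_mul_left]
        · intro m' hm' hlt' hg
          rcases (hT m').1 hm' with ⟨a, ha, rfl⟩ | ⟨b, hb, rfl⟩
          · rw [Nat.gcd_mul_left] at hg
            exact Nat.mul_le_mul_left k (hm.2.2.2 a ha (Nat.lt_of_mul_lt_mul_left hlt')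
              (Nat.lt_of_mul_lt_mul_left hg))
          · have := Nat.mul_le_mul_left k hms
            rw [mul_comm k s] at this
            omega
      have hki' : 1 < k * i := Nat.lt_of_lt_of_le hi (Nat.le_mul_of_pos_left i hk)
      have hgi := hm.2.2.1
      rw [typeAux_succ_of_isNextExponent _ hki' hnext, typeAux_succ_of_isNextExponent _ hi hm,
        Nat.gcd_mul_left, ih (by omega) (by omega) hms (hS.next hm), List.map_cons,
        List.cons_append]

theorem theType_eq_append (h : IsCompositionSupport T A B k s) {l a₀ b₀ : ℕ} (hl : 0 < l)
    (ha₀ : a₀ ∈ A) (hAmin : ∀ a ∈ A, a₀ ≤ a) (hAgcd : Nat.gcd l (A.gcd id) = 1)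
    (hb₀ : b₀ ∈ B) (hBmin : ∀ b ∈ B, b₀ ≤ b) (hb₀k : b₀ < k)
    (hBgcd : Nat.gcd k (B.gcd id) = 1) :
    theType (l * k) T =
      (theType l A).map (fun m => k * m) ++ (theType k B).map (fun m => s * k + m) := by
  have hgl : Nat.gcd l a₀ ≤ l := Nat.gcd_le_left a₀ hl
  have hmin : ∀ m ∈ T, k * a₀ ≤ m := by
    intro m hm
    rcases (h.1 m).1 hm with ⟨a, ha, rfl⟩ | ⟨b, hb, rfl⟩
    · exact Nat.mul_le_mul_left k (hAmin a ha)
    · have := Nat.mul_le_mul_left k (h.2.1 a₀ ha₀)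
      rw [mul_comm k s] at this
      omega
  rw [theType_eq_cons ((h.1 _).2 (Or.inl ⟨a₀, ha₀, rfl⟩)) hmin, theType_eq_cons ha₀ hAmin,
    mul_comm l k, Nat.gcd_mul_left,
    h.typeAux_mul hb₀ hBmin hb₀k hBgcd l hgl (Nat.mul_le_mul_left k hgl) (h.2.1 a₀ ha₀)
      (isTypeState_gcd_min hl hAmin hAgcd), List.map_cons, List.cons_append]

end IsCompositionSupport

theorem isCompositionSupport_support {P Q : Polynomial ℂ} {k s : ℕ} {c : ℂ} (hk : 0 < k)
    (hc : c ≠ 0) (hP : ∀ m ∈ P.support, m ≤ s) (hQ : ∀ m ∈ Q.support, 0 < m) :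
    IsCompositionSupport (P.comp (X ^ k) + C c * X ^ (s * k) * Q).support
      P.support Q.support k s := by
  refine ⟨fun m => ?_, hP, hQ⟩
  have hcoeff : (P.comp (X ^ k) + C c * X ^ (s * k) * Q).coeff m =
      (if k ∣ m then P.coeff (m / k) else 0) +
        c * if s * k ≤ m then Q.coeff (m - s * k) else 0 := by
    rw [← expand_eq_comp_X_pow, coeff_add, coeff_expand hk, mul_assoc, coeff_C_mul,
      coeff_X_pow_mul']
  have hQ0 : Q.coeff 0 = 0 := by
    by_contra h0
    exact lt_irrefl 0 (hQ 0 (mem_support_iff.2 h0))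
  rw [mem_support_iff, hcoeff]
  rcases le_or_gt m (s * k) with hle | hlt
  · have hsecond : (if s * k ≤ m then Q.coeff (m - s * k) else 0) = 0 := by
      rw [Nat.sub_eq_zero_of_le hle, hQ0, ite_self]
    rw [hsecond, mul_zero, add_zero]
    constructor
    · intro hne
      obtain ⟨hdvd, hne⟩ := ite_ne_right_iff.1 hne
      exact Or.inl ⟨m / k, mem_support_iff.2 hne, (Nat.mul_div_cancel' hdvd).symm⟩
    · rintro (⟨a, ha, rfl⟩ | ⟨b, hb, rfl⟩)
      · rw [if_pos (dvd_mul_right k a), Nat.mul_div_cancel_left a hk]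
        exact mem_support_iff.1 ha
      · have := hQ b hb
        omega
  · have hfirst : (if k ∣ m then P.coeff (m / k) else 0) = 0 := by
      refine ite_eq_right_iff.2 ?_
      rintro ⟨a, rfl⟩
      rw [Nat.mul_div_cancel_left a hk]
      by_contra ha
      have := Nat.mul_le_mul_left k (hP a (mem_support_iff.2 ha))
      rw [mul_comm k s] at this
      omega
    rw [hfirst, zero_add, if_pos hlt.le]
    constructor
    · intro hne
      exact Or.inr ⟨m - s * k, mem_support_iff.2 (right_ne_zero_of_mul hne), by omega⟩
    · rintro (⟨a, ha, rfl⟩ | ⟨b, hb, rfl⟩)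
      · have := Nat.mul_le_mul_left k (hP a ha)
        rw [mul_comm k s] at this
        omega
      · rw [Nat.add_sub_cancel_left]
        exact mul_ne_zero hc (mem_support_iff.1 hb)

/-- The type of the composition of two polynomial germs in pure normal form of types
`(m^{(1)}_1, …, m^{(1)}_{t₁})` and `(m^{(2)}_1, …, m^{(2)}_{t₂})` is
`(k₂m^{(1)}_1, …, k₂m^{(1)}_{t₁}, s₁k₂+m^{(2)}_1, …, s₁k₂+m^{(2)}_{t₂})`;
in particular the length of its type is `t₁ + t₂`. -/
theorem statement1 (k1 s1 j1 k2 s2 j2 : ℕ) (lam1 lam2 : ℂ) (P1 P2 : Polynomial ℂ)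
    (h1 : IsPureNormalForm k1 s1 j1 lam1 P1)
    (h2 : IsPureNormalForm k2 s2 j2 lam2 P2) :
    theType (k1 * k2) (P1.comp (X ^ k2) + C lam1 * X ^ (s1 * k2) * P2).support =
      (theType k1 P1.support).map (fun m => k2 * m) ++
        (theType k2 P2.support).map (fun m => s1 * k2 + m) ∧
    (theType (k1 * k2) (P1.comp (X ^ k2) + C lam1 * X ^ (s1 * k2) * P2).support).length =
      (theType k1 P1.support).length + (theType k2 P2.support).length := by
  obtain ⟨hk1, -, -, -, -, hlam1, hj1, hP1, hgcd1⟩ := h1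
  obtain ⟨hk2, -, hj2pos, hj2k, -, -, hj2, hP2, hgcd2⟩ := h2
  have hT := isCompositionSupport_support (P := P1) (Q := P2) (k := k2) (s := s1) (by omega)
    hlam1 (fun m hm => (hP1 m (mem_support_iff.1 hm)).2)
    (fun m hm => hj2pos.trans_le (hP2 m (mem_support_iff.1 hm)).1)
  have key := hT.theType_eq_append (l := k1) (by omega)
    (mem_support_iff.2 (by simp [hj1])) (fun m hm => (hP1 m (mem_support_iff.1 hm)).1) hgcd1
    (mem_support_iff.2 (by simp [hj2])) (fun m hm => (hP2 m (mem_support_iff.1 hm)).1) hj2k hgcd2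
  exact ⟨key, by simp [key]⟩
end

section
/- Let φ(z,ζ) = (λ ζ^s z + P(ζ), ζ^k) be a polynomial germ in pure normal form with P(ζ) = Σ_{m=j}^{s} c_m ζ^m, and suppose d := gcd(j, k) > 1. Let m* := min{m : c_m ≠ 0 and d ∤ m} (this minimum exists), and define k₁ := k/d, j₁ := j/d, s₁ := ⌊(m*−1)/d⌋, k₂ := d, j₂ := m* − s₁d, s₂ := s − s₁d, λ₁ := c_{m*}, λ₂ := λ/λ₁, P₁(ζ) := Σ_{m=j, d|m}^{s₁d} c_m ζ^{m/d}, and P₂(ζ) := Σ_{m=m*}^{s} λ₁^{−1} c_m ζ^{m − s₁d}. Then: (a) λ₁ ≠ 0; (b) the maps φ₁(z,ζ) := (λ₁ ζ^{s₁} z + P₁(ζ), ζ^{k₁}) and φ₂(z,ζ) := (λ₂ ζ^{s₂} z + P₂(ζ), ζ^{k₂}) are polynomial germs in pure normal form (in particular 0 < j₁ < k₁, j₁ ≤ s₁, 0 < j₂ < k₂, j₂ ≤ s₂, gcd({k₂} ∪ {m − s₁d : m ≥ m*, c_m ≠ 0}) = 1); (c) gcd(j₁, k₁) = 1, i.e.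 φ₁ is of simple type; and (d) φ = φ₁ ∘ φ₂ as maps ℂ² → ℂ². -/
open Polynomial

/-- Coefficients of the polynomial collecting the terms of `P` with exponents in `[a, e * d]`
divisible by `d`, with exponents divided by `d`. -/
theorem coeff_sum_filter_dvd {R : Type*} [Semiring R] (P : Polynomial R) {d : ℕ} (hd : 0 < d)
    (a e n : ℕ) :
    (∑ m ∈ (Finset.Icc a (e * d)).filter (fun m => d ∣ m),
      C (P.coeff m) * X ^ (m / d)).coeff n =
      if a ≤ n * d ∧ n ≤ e then P.coeff (n * d) else 0 := by
  simp only [finsetSum_coeff, coeff_C_mul_X_pow]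
  split_ifs with hn
  · rw [Finset.sum_eq_single (n * d)]
    · simp [Nat.mul_div_cancel n hd]
    · intro m hm hne
      simp only [Finset.mem_filter] at hm
      refine if_neg fun hnm => hne ?_
      rw [hnm, Nat.div_mul_cancel hm.2]
    · intro hm
      exact absurd (Finset.mem_filter.2 ⟨Finset.mem_Icc.2
        ⟨hn.1, Nat.mul_le_mul_right d hn.2⟩, Dvd.intro_left n rfl⟩) hm
  · refine Finset.sum_eq_zero fun m hm => if_neg fun hnm => hn ?_
    simp only [Finset.mem_filter, Finset.mem_Icc] at hm
    have hnd : n * d = m := by rw [hnm, Nat.div_mul_cancel hm.2]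
    exact ⟨hnd ▸ hm.1.1, Nat.le_of_mul_le_mul_right (hnd ▸ hm.1.2) hd⟩

/-- Coefficients of the polynomial obtained from the terms of `a • P` with exponents in `[b, s]`
by lowering the exponents by `t`. -/
theorem coeff_sum_Icc_shift {R : Type*} [Semiring R] (P : Polynomial R) (a : R) {b t : ℕ}
    (htb : t ≤ b) (s n : ℕ) :
    (∑ m ∈ Finset.Icc b s, C (a * P.coeff m) * X ^ (m - t)).coeff n =
      if b ≤ n + t ∧ n + t ≤ s then a * P.coeff (n + t) else 0 := by
  simp only [finsetSum_coeff, coeff_C_mul_X_pow]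
  split_ifs with hn
  · rw [Finset.sum_eq_single (n + t)]
    · simp
    · intro m hm hne
      simp only [Finset.mem_Icc] at hm
      exact if_neg (by omega)
    · intro hm
      exact absurd (Finset.mem_Icc.2 hn) hm
  · refine Finset.sum_eq_zero fun m hm => if_neg ?_
    simp only [Finset.mem_Icc] at hm
    omega

/-- Canonical splitting step for a germ in pure normal form with `d = gcd(j,k) > 1`:
with `m* := min{m : c_m ≠ 0, d ∤ m}` (which exists), `k₁ := k/d`, `j₁ := j/d`,
`s₁ := ⌊(m*−1)/d⌋`, `k₂ := d`, `j₂ := m* − s₁d`, `s₂ := s − s₁d`, `λ₁ := c_{m*}`,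
`λ₂ := λ/λ₁`, `P₁ := Σ_{m=j, d∣m}^{s₁d} c_m ζ^{m/d}` and
`P₂ := Σ_{m=m*}^{s} λ₁⁻¹ c_m ζ^{m−s₁d}`, one gets `λ₁ ≠ 0`, two germs `φ₁, φ₂` in pure
normal form, with `φ₁` of simple type, and `φ = φ₁ ∘ φ₂`. -/
theorem statement2 (k s j : ℕ) (lam : ℂ) (P : Polynomial ℂ)
    (h : IsPureNormalForm k s j lam P)
    (d : ℕ) (hd : d = Nat.gcd j k) (hd1 : 1 < d)
    (mstar k1 j1 s1 k2 j2 s2 : ℕ) (lam1 lam2 : ℂ) (P1 P2 : Polynomial ℂ)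
    (hmstar : mstar = sInf {m : ℕ | P.coeff m ≠ 0 ∧ ¬ d ∣ m})
    (hk1 : k1 = k / d) (hj1 : j1 = j / d) (hs1 : s1 = (mstar - 1) / d)
    (hk2 : k2 = d) (hj2 : j2 = mstar - s1 * d) (hs2 : s2 = s - s1 * d)
    (hlam1 : lam1 = P.coeff mstar) (hlam2 : lam2 = lam / lam1)
    (hP1 : P1 = ∑ m ∈ (Finset.Icc j (s1 * d)).filter (fun m => d ∣ m),
      C (P.coeff m) * X ^ (m / d))
    (hP2 : P2 = ∑ m ∈ Finset.Icc mstar s, C (lam1⁻¹ * P.coeff m) * X ^ (m - s1 * d)) :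
    {m : ℕ | P.coeff m ≠ 0 ∧ ¬ d ∣ m}.Nonempty ∧
    lam1 ≠ 0 ∧
    IsPureNormalForm k1 s1 j1 lam1 P1 ∧
    IsPureNormalForm k2 s2 j2 lam2 P2 ∧
    Nat.gcd j1 k1 = 1 ∧
    germ k1 s1 lam1 P1 ∘ germ k2 s2 lam2 P2 = germ k s lam P := by
  obtain ⟨hk, hs, hj, hjk, hjs, hlam, hPj, hsupp, hgcd⟩ := h
  have hdj : d ∣ j := hd ▸ Nat.gcd_dvd_left j k
  have hdk : d ∣ k := hd ▸ Nat.gcd_dvd_right j k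
  have hd0 : 0 < d := by omega
  have hne : {m : ℕ | P.coeff m ≠ 0 ∧ ¬ d ∣ m}.Nonempty := by
    by_contra hempty
    have hdvd : d ∣ Nat.gcd k (P.support.gcd id) := by
      refine Nat.dvd_gcd hdk (Finset.dvd_gcd fun m hm => ?_)
      by_contra hdm
      exact hempty ⟨m, mem_support_iff.1 hm, hdm⟩
    rw [hgcd, Nat.dvd_one] at hdvd
    omega
  obtain ⟨hcm, hdm⟩ : P.coeff mstar ≠ 0 ∧ ¬ d ∣ mstar := hmstar ▸ Nat.sInf_mem hne
  have hmin : ∀ m, P.coeff m ≠ 0 → m < mstar → d ∣ m := fun m hm hlt => by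
    by_contra hdvd
    exact Nat.notMem_of_lt_sInf (s := {m : ℕ | P.coeff m ≠ 0 ∧ ¬ d ∣ m}) (hmstar ▸ hlt) ⟨hm, hdvd⟩
  obtain ⟨hjm, hms⟩ := hsupp _ hcm
  have hlt : s1 * d < mstar := by
    have := Nat.div_mul_le_self (mstar - 1) d
    rw [← hs1] at this
    omega
  have hgt : mstar < s1 * d + d := by
    have h1 : mstar - 1 < s1 * d + d := by
      have := Nat.lt_mul_div_succ (mstar - 1) hd0
      rw [← hs1] at this
      linarith
    have h2 : mstar ≠ s1 * d + d := fun he => hdm (he ▸ ⟨s1 + 1, by ring⟩)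
    omega
  have hmul_le : ∀ n, n * d < mstar → n ≤ s1 := fun n hn => by
    by_contra! hsn
    have : (s1 + 1) * d ≤ n * d := Nat.mul_le_mul_right d hsn
    linarith
  have hj1d : j1 * d = j := by rw [hj1, Nat.div_mul_cancel hdj]
  have hk1d : k1 * d = k := by rw [hk1, Nat.div_mul_cancel hdk]
  have hjne : j ≠ mstar := fun he => hdm (he ▸ hdj)
  have hj1s1 : j1 ≤ s1 := hmul_le j1 (by omega)
  have hj1pos : 0 < j1 := Nat.pos_of_ne_zero fun h0 => by simp [h0] at hj1d; omega
  have hj1k1 : j1 < k1 := Nat.lt_of_mul_lt_mul_right (a := d) (by omega)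
  have hlam1ne : lam1 ≠ 0 := hlam1 ▸ hcm
  have hcop : Nat.gcd j1 k1 = 1 := by
    rw [hj1, hk1, hd]
    exact Nat.gcd_div_gcd_div_gcd_of_pos_left hj
  have hP1c (n : ℕ) : P1.coeff n = if j ≤ n * d ∧ n ≤ s1 then P.coeff (n * d) else 0 :=
    hP1 ▸ coeff_sum_filter_dvd P hd0 j s1 n
  have hP2c (n : ℕ) : P2.coeff n =
      if mstar ≤ n + s1 * d ∧ n + s1 * d ≤ s then lam1⁻¹ * P.coeff (n + s1 * d) else 0 :=
    hP2 ▸ coeff_sum_Icc_shift P lam1⁻¹ hlt.le s n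
  have hP1j : P1.coeff j1 = 1 := by
    rw [hP1c, hj1d, if_pos ⟨le_rfl, hj1s1⟩, hPj]
  have hsplit : C lam1 * P2 * X ^ (s1 * d) + expand ℂ d P1 = P := by
    ext n
    rw [coeff_add, coeff_mul_X_pow', coeff_expand hd0, coeff_C_mul, hP2c, hP1c]
    rcases lt_or_ge n mstar with hn | hn
    · have hfirst : (if s1 * d ≤ n then lam1 *
          (if mstar ≤ n - s1 * d + s1 * d ∧ n - s1 * d + s1 * d ≤ s then
            lam1⁻¹ * P.coeff (n - s1 * d + s1 * d) else 0) else 0) = 0 := by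
        split_ifs <;> first | rfl | omega | simp
      rw [hfirst, zero_add]
      by_cases hdn : d ∣ n
      · rw [if_pos hdn, Nat.div_mul_cancel hdn]
        split_ifs with hc
        · rfl
        · by_contra hne0
          exact hc ⟨(hsupp n (Ne.symm hne0)).1,
            hmul_le _ (by rwa [Nat.div_mul_cancel hdn])⟩
      · rw [if_neg hdn]
        by_contra hne0
        exact hdn (hmin n (Ne.symm hne0) hn)
    · have hsecond : (if d ∣ n then
          (if j ≤ n / d * d ∧ n / d ≤ s1 then P.coeff (n / d * d) else 0) else 0) = 0 := by
        split_ifs with hdn hc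
        · have := Nat.mul_le_mul_right d hc.2
          rw [Nat.div_mul_cancel hdn] at this
          omega
        · rfl
        · rfl
      rw [hsecond, add_zero, if_pos (by omega), Nat.sub_add_cancel (by omega)]
      split_ifs with hc
      · rw [mul_inv_cancel_left₀ hlam1ne]
      · by_contra hne0
        refine hc ⟨hn, (hsupp n fun h0 => hne0 ?_).2⟩
        rw [h0, mul_zero]
  refine ⟨hne, hlam1ne, ⟨by omega, by omega, hj1pos, hj1k1, hj1s1, hlam1ne, hP1j, ?_, ?_⟩,
    ⟨by omega, by omega, by omega, by omega, by omega, hlam2 ▸ div_ne_zero hlam hlam1ne,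
      ?_, ?_, ?_⟩, hcop, ?_⟩
  · intro m hm
    rw [hP1c] at hm
    obtain ⟨hc, -⟩ := ite_ne_right_iff.1 hm
    exact ⟨Nat.le_of_mul_le_mul_right (hj1d.symm ▸ hc.1) hd0, hc.2⟩
  · refine Nat.dvd_one.1 (hcop ▸ Nat.dvd_gcd ?_ (Nat.gcd_dvd_left _ _))
    exact (Nat.gcd_dvd_right _ _).trans
      (Finset.gcd_dvd (f := id) (mem_support_iff.2 (hP1j ▸ one_ne_zero)))
  · have : j2 + s1 * d = mstar := by omega
    rw [hP2c, this, if_pos ⟨le_rfl, hms⟩, ← hlam1, inv_mul_cancel₀ hlam1ne]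
  · intro m hm
    rw [hP2c] at hm
    obtain ⟨hc, -⟩ := ite_ne_right_iff.1 hm
    omega
  · set g := Nat.gcd k2 (P2.support.gcd id) with hg
    have hgd : g ∣ d := hk2 ▸ Nat.gcd_dvd_left _ _
    refine Nat.dvd_one.1 (hgcd ▸ Nat.dvd_gcd (hgd.trans hdk) (Finset.dvd_gcd fun m hm => ?_))
    have hm0 := mem_support_iff.1 hm
    rcases lt_or_ge m mstar with hlt' | hge
    · exact hgd.trans (hmin m hm0 hlt')
    · have hms1 : m - s1 * d + s1 * d = m := by omega
      have hmem : m - s1 * d ∈ P2.support := by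
        rw [mem_support_iff, hP2c, hms1, if_pos ⟨hge, (hsupp m hm0).2⟩]
        exact mul_ne_zero (inv_ne_zero hlam1ne) hm0
      have hdvd : g ∣ m - s1 * d :=
        (Nat.gcd_dvd_right _ _).trans (Finset.gcd_dvd (f := id) hmem)
      rw [id, ← hms1]
      exact dvd_add hdvd (hgd.mul_left s1)
  · funext ⟨z, w⟩
    have hP : P.eval w = lam1 * P2.eval w * w ^ (s1 * d) + P1.eval (w ^ d) := by
      conv_lhs => rw [← hsplit]
      simp [expand_eval]
    have hs12 : s = s1 * d + s2 := by omega
    have hlam12 : lam = lam1 * lam2 := by rw [hlam2, mul_div_cancel₀ _ hlam1ne]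
    simp only [germ, Function.comp_apply, Prod.mk.injEq]
    constructor
    · rw [hP, hs12, hlam12, hk2, ← pow_mul]
      ring
    · rw [← pow_mul, hk2, mul_comm, hk1d]
end

section
/- Let φ be a polynomial germ in pure normal form whose type has length t. Then there exist polynomial germs φ₁, …, φ_t, each in pure normal form and each of simple type (i.e., with gcd of its invariants j_i and k_i equal to 1), such that φ = φ₁ ∘ φ₂ ∘ … ∘ φ_t as maps ℂ² → ℂ². -/
open Polynomial

/-- Beyond `prev`, translating `S` by a multiple of `i` does not change the length of `typeAux`,
which is moreover independent of the fuel once the latter is at least `i`. -/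
lemma length_typeAux_eq_of_shift (c : ℕ) (S T : Finset ℕ) (f g i p : ℕ) (hi : 0 < i)
    (hf : i ≤ f) (hg : i ≤ g) (hc : i ∣ c) (hST : ∀ m, p < m → (m ∈ T ↔ m + c ∈ S)) :
    (typeAux S f i (p + c)).length = (typeAux T g i p).length := by
  induction f generalizing g i p with
  | zero => omega
  | succ f ih =>
    obtain ⟨g, rfl⟩ : ∃ g', g = g' + 1 := ⟨g - 1, by omega⟩
    have hgcd (m : ℕ) : Nat.gcd i (m + c) = Nat.gcd i m := by
      obtain ⟨d, rfl⟩ := hc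
      simp
    have hmem (m : ℕ) : m + c ∈ S.filter (fun m => p + c < m ∧ Nat.gcd i m < i) ↔
        m ∈ T.filter (fun m => p < m ∧ Nat.gcd i m < i) := by
      simp only [Finset.mem_filter, hgcd, add_lt_add_iff_right]
      constructor
      · rintro ⟨h1, h2, h3⟩
        exact ⟨(hST m h2).2 h1, h2, h3⟩
      · rintro ⟨h1, h2, h3⟩
        exact ⟨(hST m h2).1 h1, h2, h3⟩
    have hsub (m : ℕ) (hm : m ∈ S.filter (fun m => p + c < m ∧ Nat.gcd i m < i)) :
        m - c ∈ T.filter (fun m => p < m ∧ Nat.gcd i m < i) ∧ m = m - c + c := by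
      have hlt := (Finset.mem_filter.1 hm).2.1
      have heq : m = m - c + c := by omega
      exact ⟨(hmem _).1 (heq ▸ hm), heq⟩
    rw [typeAux, typeAux]
    by_cases h1 : i ≤ 1
    · simp [h1]
    rw [if_neg h1, if_neg h1]
    by_cases hT : (T.filter (fun m => p < m ∧ Nat.gcd i m < i)).Nonempty
    · have hS : (S.filter (fun m => p + c < m ∧ Nat.gcd i m < i)).Nonempty :=
        ⟨_, (hmem _).2 (Finset.min'_mem _ hT)⟩
      rw [dif_pos hS, dif_pos hT]
      have hmin : (S.filter (fun m => p + c < m ∧ Nat.gcd i m < i)).min' hS =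
          (T.filter (fun m => p < m ∧ Nat.gcd i m < i)).min' hT + c := by
        apply le_antisymm
        · exact Finset.min'_le _ _ ((hmem _).2 (Finset.min'_mem _ hT))
        · obtain ⟨h2, h3⟩ := hsub _ (Finset.min'_mem _ hS)
          rw [h3]
          exact Nat.add_le_add_right (Finset.min'_le _ _ h2) c
      have hm := (Finset.mem_filter.1 (Finset.min'_mem _ hT)).2
      simp only [hmin, List.length_cons, hgcd]
      generalize (T.filter (fun m => p < m ∧ Nat.gcd i m < i)).min' hT = m at hm
      rw [ih g _ m (Nat.gcd_pos_of_pos_left _ hi) (by omega) (by omega)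
        ((Nat.gcd_dvd_left _ _).trans hc) fun n hn => hST n (hm.1.trans hn)]
    · have hS : ¬ (S.filter (fun m => p + c < m ∧ Nat.gcd i m < i)).Nonempty :=
        fun ⟨m, hm⟩ => hT ⟨_, (hsub m hm).1⟩
      rw [dif_neg hS, dif_neg hT]

lemma IsPureNormalForm.theType_eq {k s j : ℕ} {lam : ℂ} {P : ℂ[X]}
    (h : IsPureNormalForm k s j lam P) :
    theType k P.support = j :: typeAux P.support k (Nat.gcd k j) j := by
  obtain ⟨-, -, -, -, -, -, hj, hP, -⟩ := h
  have hjS : j ∈ P.support := by simp [hj]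
  have hmin : P.support.min' ⟨j, hjS⟩ = j :=
    le_antisymm (Finset.min'_le _ _ hjS)
      (Finset.le_min' _ _ _ fun m hm => (hP m (mem_support_iff.1 hm)).1)
  rw [theType, dif_pos ⟨j, hjS⟩, hmin]

lemma exists_polynomial_coeff_eq {R : Type*} [Semiring R] (N : ℕ) (f : ℕ → R) :
    ∃ Q : R[X], ∀ n, Q.coeff n = if n ≤ N then f n else 0 := by
  refine ⟨∑ n ∈ Finset.range (N + 1), monomial n (f n), fun n => ?_⟩
  simp [coeff_monomial]

lemma germ_comp_germ (k₁ k₂ s₁ s₂ : ℕ) (a b : ℂ) (P Q : ℂ[X]) :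
    germ k₁ s₁ a P ∘ germ k₂ s₂ b Q =
      germ (k₂ * k₁) (k₂ * s₁ + s₂) (a * b) (expand ℂ k₂ P + C a * (X ^ (k₂ * s₁) * Q)) := by
  ext ⟨z, w⟩
  · simp [germ, expand_eval]
    ring
  · simp [germ, pow_mul]

/-- A germ in pure normal form that is not of simple type splits off a germ of simple type on the
left, leaving a germ whose type is shorter by one. -/
lemma IsPureNormalForm.exists_eq_comp {k s j : ℕ} {lam : ℂ} {P : ℂ[X]}
    (h : IsPureNormalForm k s j lam P) (hg : Nat.gcd k j ≠ 1) :
    ∃ (k₁ s₁ j₁ k₂ s₂ j₂ : ℕ) (a b : ℂ) (P₁ P₂ : ℂ[X]),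
      IsPureNormalForm k₁ s₁ j₁ a P₁ ∧ Nat.gcd j₁ k₁ = 1 ∧
      IsPureNormalForm k₂ s₂ j₂ b P₂ ∧ k₂ < k ∧
      (theType k P.support).length = (theType k₂ P₂.support).length + 1 ∧
      germ k s lam P = germ k₁ s₁ a P₁ ∘ germ k₂ s₂ b P₂ := by
  have htype := h.theType_eq
  obtain ⟨hk, hs, hj0, hjk, hjs, hlam, hj, hP, hgcd⟩ := h
  obtain ⟨d, hd⟩ : ∃ d, d = Nat.gcd k j := ⟨_, rfl⟩
  rw [← hd] at htype hg
  have hdk : d ∣ k := hd ▸ Nat.gcd_dvd_left _ _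
  have hdj : d ∣ j := hd ▸ Nat.gcd_dvd_right _ _
  have hd0 : 0 < d := hd ▸ Nat.gcd_pos_of_pos_right _ hj0
  have hd1 : 1 < d := by omega
  have hdlt : d < k := (Nat.le_of_dvd hj0 hdj).trans_lt hjk
  have hne : (P.support.filter fun m => j < m ∧ Nat.gcd d m < d).Nonempty := by
    by_contra hcon
    rw [Finset.not_nonempty_iff_eq_empty, Finset.filter_eq_empty_iff] at hcon
    apply hg
    rw [← Nat.dvd_one, ← hgcd]
    refine Nat.dvd_gcd hdk (Finset.dvd_gcd fun m hm => ?_)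
    have hjm := (hP m (mem_support_iff.1 hm)).1
    rcases hjm.eq_or_lt with rfl | hlt
    · exact hdj
    · have := hcon hm
      have hle := Nat.gcd_le_left m hd0
      exact Nat.gcd_eq_left_iff_dvd.1 (by dsimp at *; omega)
  obtain ⟨n, hn⟩ : ∃ n, n = (P.support.filter fun m => j < m ∧ Nat.gcd d m < d).min' hne :=
    ⟨_, rfl⟩
  have hnmem := Finset.mem_filter.1 (hn ▸ Finset.min'_mem _ hne)
  obtain ⟨hnS, hjn, hdn⟩ := hnmem
  have hcn : P.coeff n ≠ 0 := mem_support_iff.1 hnS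
  have hdvd (m : ℕ) (hm : P.coeff m ≠ 0) (hmn : m < n) : d ∣ m := by
    rcases (hP m hm).1.eq_or_lt with rfl | hlt
    · exact hdj
    by_contra hnd
    have hle := Nat.gcd_le_left m hd0
    have hneq : Nat.gcd d m ≠ d := fun he => hnd (Nat.gcd_eq_left_iff_dvd.1 he)
    have hmin := Finset.min'_le _ m (Finset.mem_filter.2 ⟨mem_support_iff.2 hm, hlt, by omega⟩ :
      m ∈ P.support.filter fun m => j < m ∧ Nat.gcd d m < d)
    omega
  have hndvd : ¬ d ∣ n := fun hdiv => by
    rw [Nat.gcd_eq_left hdiv] at hdn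
    exact lt_irrefl _ hdn
  have hr0 : 0 < n % d := Nat.pos_of_ne_zero fun h0 => hndvd (Nat.dvd_of_mod_eq_zero h0)
  have hrd : n % d < d := Nat.mod_lt _ hd0
  have hq : d * (n / d) + n % d = n := Nat.div_add_mod n d
  generalize hqe : n / d = q at hq
  generalize hre : n % d = r at hq hr0 hrd
  have hns : n ≤ s := (hP n hcn).2
  obtain ⟨k₁, rfl⟩ := hdk
  obtain ⟨j₁, rfl⟩ := hdj
  have hcop : Nat.gcd k₁ j₁ = 1 := by
    rw [Nat.gcd_mul_left] at hd
    exact Nat.eq_of_mul_eq_mul_left hd0 (by omega)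
  have hj₁0 : 0 < j₁ := Nat.pos_of_mul_pos_left hj0
  have hj₁k₁ : j₁ < k₁ := lt_of_mul_lt_mul_left hjk (Nat.zero_le d)
  have hj₁q : j₁ ≤ q := by
    rw [← hqe, Nat.le_div_iff_mul_le hd0, mul_comm]
    exact hjn.le
  -- Between `d * q` and `n` the polynomial `P` has no terms.
  have hgap (m : ℕ) (hm : P.coeff m ≠ 0) (hlt : d * q < m) : n ≤ m := by
    by_contra! hmn
    obtain ⟨e, rfl⟩ := hdvd m hm hmn
    have h1 : q < e := lt_of_mul_lt_mul_left hlt (Nat.zero_le d)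
    have h2 : d * (q + 1) ≤ d * e := Nat.mul_le_mul_left d h1
    rw [mul_add] at h2
    omega
  obtain ⟨P₁, hP₁⟩ := exists_polynomial_coeff_eq q fun m => P.coeff (d * m)
  obtain ⟨P₂, hP₂⟩ := exists_polynomial_coeff_eq s fun m =>
    if m = 0 then 0 else P.coeff (m + d * q) / P.coeff n
  have hP₂ne (m : ℕ) : P₂.coeff m ≠ 0 ↔ m ≠ 0 ∧ P.coeff (m + d * q) ≠ 0 := by
    rw [hP₂]
    constructor
    · intro hm
      split_ifs at hm with h1 h2
      · exact absurd rfl hm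
      · exact ⟨h2, (div_ne_zero_iff.1 hm).1⟩
      · exact absurd rfl hm
    · rintro ⟨h0, h1⟩
      have := (hP _ h1).2
      rw [if_pos (by omega), if_neg h0]
      exact div_ne_zero h1 hcn
  have hrn : r + d * q = n := by omega
  have hP₂r : P₂.coeff r = 1 := by
    rw [hP₂, if_pos (by omega), if_neg hr0.ne', hrn, div_self hcn]
  have hdecomp : P = expand ℂ d P₁ + C (P.coeff n) * (X ^ (d * q) * P₂) := by
    ext m
    rw [coeff_add, coeff_C_mul, coeff_expand hd0, coeff_X_pow_mul']
    rcases le_or_gt m (d * q) with hle | hlt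
    · have h2 : (if d * q ≤ m then P₂.coeff (m - d * q) else 0) = 0 := by
        split_ifs with h3
        · rw [hP₂, show m - d * q = 0 by omega]
          simp
        · rfl
      rw [h2, mul_zero, add_zero]
      split_ifs with h3
      · obtain ⟨e, rfl⟩ := h3
        rw [Nat.mul_div_cancel_left _ hd0, hP₁, if_pos (le_of_mul_le_mul_left hle hd0)]
      · by_contra h4
        exact h3 (hdvd m h4 (by omega))
    · have h1 : (if d ∣ m then P₁.coeff (m / d) else 0) = 0 := by
        split_ifs with h3
        · obtain ⟨e, rfl⟩ := h3
          rw [Nat.mul_div_cancel_left _ hd0, hP₁,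
            if_neg (not_le.2 (lt_of_mul_lt_mul_left hlt (Nat.zero_le d)))]
        · rfl
      rw [h1, zero_add, if_pos hlt.le, hP₂, if_neg (show m - d * q ≠ 0 by omega),
        Nat.sub_add_cancel hlt.le]
      split_ifs with h3
      · rw [mul_div_cancel₀ _ hcn]
      · by_contra h4
        have := (hP m (by simpa using h4)).2
        omega
  have hnf₁ : IsPureNormalForm k₁ q j₁ (P.coeff n) P₁ := by
    refine ⟨by omega, by omega, hj₁0, hj₁k₁, hj₁q, hcn, ?_, fun m hm => ?_, ?_⟩
    · rw [hP₁, if_pos hj₁q, hj]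
    · rw [hP₁] at hm
      split_ifs at hm with h1
      · exact ⟨le_of_mul_le_mul_left (hP _ hm).1 hd0, h1⟩
      · exact absurd rfl hm
    · refine Nat.dvd_one.1 (hcop ▸ Nat.gcd_dvd_gcd_of_dvd_right _ (Finset.gcd_dvd (f := id) ?_))
      rw [mem_support_iff, hP₁, if_pos hj₁q, hj]
      exact one_ne_zero
  have hnf₂ : IsPureNormalForm d (s - d * q) r (lam / P.coeff n) P₂ := by
    refine ⟨hd1, by omega, hr0, hrd, by omega, div_ne_zero hlam hcn, hP₂r, fun m hm => ?_, ?_⟩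
    · obtain ⟨h0, h1⟩ := (hP₂ne m).1 hm
      have h2 := hgap _ h1 (by omega)
      have h3 := (hP _ h1).2
      omega
    · rw [← Nat.dvd_one, ← hgcd]
      refine Nat.dvd_gcd ((Nat.gcd_dvd_left _ _).trans (dvd_mul_right _ _))
        (Finset.dvd_gcd fun m hm => ?_)
      rw [mem_support_iff] at hm
      rcases lt_or_ge m n with hmn | hmn
      · exact (Nat.gcd_dvd_left _ _).trans (hdvd m hm hmn)
      · have hm2 : m - d * q ∈ P₂.support := by
          rw [mem_support_iff, hP₂ne, Nat.sub_add_cancel (by omega)]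
          exact ⟨by omega, hm⟩
        have h1 : Nat.gcd d (P₂.support.gcd id) ∣ m - d * q :=
          (Nat.gcd_dvd_right _ _).trans (Finset.gcd_dvd (f := id) hm2)
        have h2 := dvd_add h1 ((Nat.gcd_dvd_left d (P₂.support.gcd id)).trans (dvd_mul_right d q))
        rwa [Nat.sub_add_cancel (by omega)] at h2
  refine ⟨k₁, q, j₁, d, s - d * q, r, P.coeff n, lam / P.coeff n, P₁, P₂, hnf₁,
    by rwa [Nat.gcd_comm], hnf₂, hdlt, ?_, ?_⟩
  · obtain ⟨f, hf⟩ : ∃ f, d * k₁ = f + 1 := ⟨d * k₁ - 1, by omega⟩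
    rw [htype, hnf₂.theType_eq, hf, typeAux, if_neg (by omega), dif_pos hne]
    simp only [← hn, List.length_cons]
    have hgr : Nat.gcd d n = Nat.gcd d r := by
      rw [← hrn]
      simp
    rw [hgr] at hdn ⊢
    rw [← hrn, length_typeAux_eq_of_shift (d * q) _ P₂.support f d _ r
      (Nat.gcd_pos_of_pos_left _ hd0) (by omega) hdn.le
      ((Nat.gcd_dvd_left _ _).trans (dvd_mul_right _ _))]
    intro m hm
    rw [mem_support_iff, mem_support_iff, hP₂ne]
    exact ⟨fun h1 => h1.2, fun h1 => ⟨by omega, h1⟩⟩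
  · rw [germ_comp_germ, ← hdecomp, mul_div_cancel₀ _ hcn, Nat.add_sub_cancel' (by omega)]

lemma IsPureNormalForm.exists_list_simple {k s j : ℕ} {lam : ℂ} {P : ℂ[X]}
    (h : IsPureNormalForm k s j lam P) :
    ∃ L : List (ℕ × ℕ × ℕ × ℂ × ℂ[X]), L.length = (theType k P.support).length ∧
      (∀ x ∈ L, IsPureNormalForm x.1 x.2.1 x.2.2.1 x.2.2.2.1 x.2.2.2.2 ∧
        Nat.gcd x.2.2.1 x.1 = 1) ∧
      germ k s lam P =
        (L.map fun x => germ x.1 x.2.1 x.2.2.2.1 x.2.2.2.2).foldr (· ∘ ·) id := by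
  induction k using Nat.strong_induction_on generalizing s j lam P with
  | _ k ih =>
    by_cases hg : Nat.gcd k j = 1
    · refine ⟨[(k, s, j, lam, P)], ?_, ?_, ?_⟩
      · obtain ⟨f, rfl⟩ : ∃ f, k = f + 1 := ⟨k - 1, by have := h.1; omega⟩
        rw [h.theType_eq, hg, typeAux, if_pos le_rfl]
        rfl
      · simpa [Nat.gcd_comm j k] using ⟨h, hg⟩
      · simp
    · obtain ⟨k₁, s₁, j₁, k₂, s₂, j₂, a, b, P₁, P₂, h₁, hg₁, h₂, hlt, hlen, hcomp⟩ :=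
        h.exists_eq_comp hg
      obtain ⟨L, hL, hLnf, hLcomp⟩ := ih k₂ hlt h₂
      refine ⟨(k₁, s₁, j₁, a, P₁) :: L, by rw [List.length_cons, hL, hlen], ?_, ?_⟩
      · rintro x (_ | ⟨_, hx⟩)
        · exact ⟨h₁, hg₁⟩
        · exact hLnf x hx
      · rw [hcomp, hLcomp]
        rfl


/-- A polynomial germ in pure normal form whose type has length `t` decomposes as a
composition `φ = φ₁ ∘ … ∘ φ_t` of `t` polynomial germs in pure normal form, each of
simple type (i.e. `gcd(jᵢ,kᵢ) = 1`). -/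
theorem statement3 (k s j : ℕ) (lam : ℂ) (P : Polynomial ℂ)
    (h : IsPureNormalForm k s j lam P) :
    ∃ (ks ss js : Fin (theType k P.support).length → ℕ)
      (lams : Fin (theType k P.support).length → ℂ)
      (Ps : Fin (theType k P.support).length → Polynomial ℂ),
      (∀ i, IsPureNormalForm (ks i) (ss i) (js i) (lams i) (Ps i)) ∧
      (∀ i, Nat.gcd (js i) (ks i) = 1) ∧
      germ k s lam P =
        (List.ofFn fun i => germ (ks i) (ss i) (lams i) (Ps i)).foldr (· ∘ ·) id := by
  obtain ⟨L, hL, hnf, hcomp⟩ := h.exists_list_simple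
  rw [← hL]
  refine ⟨fun i => (L.get i).1, fun i => (L.get i).2.1, fun i => (L.get i).2.2.1,
    fun i => (L.get i).2.2.2.1, fun i => (L.get i).2.2.2.2,
    fun i => (hnf _ (L.get_mem i)).1, fun i => (hnf _ (L.get_mem i)).2, ?_⟩
  rw [hcomp]
  congr 1
  apply List.ext_getElem <;> simp
end

section
/- Let k ≥ 2 be an integer and S a finite nonempty set of positive integers with gcd({k} ∪ S) = 1 and k ∤ max S. Let (n₁, …, n_t) be the (decreasing) type of S with respect to k. For each divisor d of k with 1 ≤ d < k, the set {n ∈ S : (k/d) ∤ n} is nonempty, so n'_d := max{n ∈ S : (k/d) ∤ n} is well defined. Then {n₁, …, n_t} = {n'_d : d ∣ k, 1 ≤ d < k}. -/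
/-- Auxiliary recursion computing the decreasing type: given the current gcd `i` and the
previously chosen exponent `prev`, choose `n_{α+1} := max {n ∈ S : n < prev, gcd(i,n) < i}`
and continue with `i_{α+1} := gcd(i, n_{α+1})`, stopping as soon as `i = 1`. -/
def typeAuxDec (S : Finset ℕ) : ℕ → ℕ → ℕ → List ℕ
  | 0, _, _ => []
  | fuel + 1, i, prev =>
    if i ≤ 1 then []
    else if h : (S.filter fun n => n < prev ∧ Nat.gcd i n < i).Nonempty then
      let m := (S.filter fun n => n < prev ∧ Nat.gcd i n < i).max' h
      m :: typeAuxDec S fuel (Nat.gcd i m) m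
    else []

/-- The decreasing type `(n₁, …, n_t)` of a finite set `S` of positive integers with
respect to `k`: `n₁ := max S`, `j₁ := gcd(k,n₁)`,
`n_α := max{n ∈ S : n < n_{α−1}, gcd(j_{α−1},n) < j_{α−1}}`, `j_α := gcd(j_{α−1}, n_α)`,
stopping at the first index `t` with `j_t = 1`. -/
def theTypeDec (k : ℕ) (S : Finset ℕ) : List ℕ :=
  if h : S.Nonempty then
    S.max' h :: typeAuxDec S k (Nat.gcd k (S.max' h)) (S.max' h)
  else []

/-- If `m` is the largest element of `S` not divisible by `e`, then the
supremum of the elements of `S` not divisible by `e` is `m`. -/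
theorem sup_filter_not_dvd_eq {S : Finset ℕ} {e m : ℕ} (hm : m ∈ S) (hem : ¬ e ∣ m)
    (hlt : ∀ n ∈ S, m < n → e ∣ n) : (S.filter fun n => ¬ e ∣ n).sup id = m := by
  apply le_antisymm
  · refine Finset.sup_le fun n hn => ?_
    rw [Finset.mem_filter] at hn
    by_contra hmn
    exact hn.2 (hlt n hn.1 (not_le.mp hmn))
  · exact Finset.le_sup (f := id) (Finset.mem_filter.mpr ⟨hm, hem⟩)

/-- If `m` is the largest element of `S` not divisible by `i`, the values
`max {n ∈ S : e ∤ n}` for the divisors `e > 1` of `i` are `m` together with those for the divisors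
`e > 1` of `gcd i m`. -/
theorem exists_dvd_sup_filter_iff {S : Finset ℕ} {i m : ℕ} (hi : 1 < i) (hm : m ∈ S)
    (him : ¬ i ∣ m) (hlt : ∀ n ∈ S, m < n → i ∣ n) (x : ℕ) :
    (∃ e, e ∣ i ∧ 1 < e ∧ x = (S.filter fun n => ¬ e ∣ n).sup id) ↔
      x = m ∨ ∃ e, e ∣ Nat.gcd i m ∧ 1 < e ∧ x = (S.filter fun n => ¬ e ∣ n).sup id := by
  constructor
  · rintro ⟨e, hei, he, rfl⟩
    by_cases hem : e ∣ m
    · exact Or.inr ⟨e, Nat.dvd_gcd hei hem, he, rfl⟩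
    · exact Or.inl (sup_filter_not_dvd_eq hm hem fun n hn h => hei.trans (hlt n hn h))
  · rintro (rfl | ⟨e, he, h⟩)
    · exact ⟨i, dvd_rfl, hi, (sup_filter_not_dvd_eq hm him hlt).symm⟩
    · exact ⟨e, he.trans (Nat.gcd_dvd_left i m), h⟩

/-- A modulus `e > 1` dividing `k` fails to divide some element of `S` when
`gcd({k} ∪ S) = 1`. -/
theorem exists_mem_not_dvd {S : Finset ℕ} {k e : ℕ} (hgcd : Nat.gcd k (S.gcd id) = 1)
    (hek : e ∣ k) (he : 1 < e) : ∃ n ∈ S, ¬ e ∣ n := by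
  by_contra! h
  have : e ∣ 1 := hgcd ▸ Nat.dvd_gcd hek (Finset.dvd_gcd h)
  exact he.ne' (Nat.dvd_one.mp this)

theorem gcd_lt_iff_not_dvd {i n : ℕ} (hi : 0 < i) : Nat.gcd i n < i ↔ ¬ i ∣ n := by
  rw [← Nat.gcd_eq_left_iff_dvd]
  have := Nat.gcd_le_left n hi
  omega

theorem mem_typeAuxDec_iff {S : Finset ℕ} (x fuel : ℕ) : ∀ i prev : ℕ, i ≤ fuel → 0 < i →
    Nat.gcd i (S.gcd id) = 1 → (∀ n ∈ S, prev ≤ n → i ∣ n) →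
    (x ∈ typeAuxDec S fuel i prev ↔
      ∃ e, e ∣ i ∧ 1 < e ∧ x = (S.filter fun n => ¬ e ∣ n).sup id) := by
  induction fuel with
  | zero => intro i prev h h0; omega
  | succ fuel ih =>
    intro i prev hfuel hi0 hgcd hprev
    rw [typeAuxDec]
    split_ifs with hi h
    · simp only [List.not_mem_nil, false_iff]
      rintro ⟨e, hei, he, -⟩
      exact absurd (Nat.le_of_dvd hi0 hei) (by omega)
    · set m := (S.filter fun n => n < prev ∧ Nat.gcd i n < i).max' h with hm
      obtain ⟨hmS, -, hlt⟩ := Finset.mem_filter.mp (Finset.max'_mem _ h)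
      rw [← hm] at hmS hlt
      have habove : ∀ n ∈ S, m < n → i ∣ n := by
        intro n hn hmn
        by_contra hin
        have hnp : n < prev := by
          by_contra hnp
          exact hin (hprev n hn (not_lt.mp hnp))
        have := Finset.le_max' (S.filter fun n => n < prev ∧ Nat.gcd i n < i) n
          (Finset.mem_filter.mpr ⟨hn, hnp, (gcd_lt_iff_not_dvd hi0).mpr hin⟩)
        omega
      rw [exists_dvd_sup_filter_iff (not_le.mp hi) hmS ((gcd_lt_iff_not_dvd hi0).mp hlt) habove]
      rw [List.mem_cons, ih (Nat.gcd i m) m (by omega) (Nat.gcd_pos_of_pos_left m hi0)]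
      · exact Nat.Coprime.coprime_dvd_left (Nat.gcd_dvd_left i m) hgcd
      · intro n hn hmn
        rcases hmn.eq_or_lt with rfl | hmn
        · exact Nat.gcd_dvd_right i m
        · exact (Nat.gcd_dvd_left i m).trans (habove n hn hmn)
    · obtain ⟨n, hn, hin⟩ := exists_mem_not_dvd hgcd dvd_rfl (not_le.mp hi)
      refine absurd ⟨n, Finset.mem_filter.mpr ⟨hn, ?_, (gcd_lt_iff_not_dvd hi0).mpr hin⟩⟩ h
      by_contra hnp
      exact hin (hprev n hn (not_lt.mp hnp))

/-- For each divisor `d` of `k` with `1 ≤ d < k`, the set `{n ∈ S : (k/d) ∤ n}` is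
nonempty, so `n'_d := max{n ∈ S : (k/d) ∤ n}` is well defined, and the set of entries of
the decreasing type `(n₁, …, n_t)` of `S` with respect to `k` is exactly
`{n'_d : d ∣ k, 1 ≤ d < k}`. -/
theorem statement4 (k : ℕ) (hk : 2 ≤ k) (S : Finset ℕ) (hS : S.Nonempty)
    (hpos : ∀ n ∈ S, 0 < n)
    (hgcd : Nat.gcd k (S.gcd id) = 1)
    (hmax : ¬ k ∣ S.max' hS) :
    (∀ d : ℕ, d ∣ k → 1 ≤ d → d < k → (S.filter fun n => ¬ (k / d) ∣ n).Nonempty) ∧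
    (theTypeDec k S).toFinset =
      (k.divisors.filter fun d => d < k).image
        (fun d => (S.filter fun n => ¬ (k / d) ∣ n).sup id) := by
  have hk0 : 0 < k := by omega
  have one_lt_div : ∀ d : ℕ, d ∣ k → d < k → 1 < k / d := by
    rintro d ⟨e, rfl⟩ hlt
    have hd : 0 < d := Nat.pos_of_mul_pos_right hk0
    rw [Nat.mul_div_cancel_left e hd]
    by_contra he
    exact absurd (Nat.mul_le_mul_left d (not_lt.mp he)) (by omega)
  refine ⟨fun d hd _ hlt => ?_, ?_⟩
  · obtain ⟨n, hn, h⟩ := exists_mem_not_dvd hgcd (Nat.div_dvd_of_dvd hd) (one_lt_div d hd hlt)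
    exact ⟨n, Finset.mem_filter.mpr ⟨hn, h⟩⟩
  ext x
  rw [theTypeDec, dif_pos hS, List.mem_toFinset, List.mem_cons,
    mem_typeAuxDec_iff x k _ _ (Nat.gcd_le_left _ hk0) (Nat.gcd_pos_of_pos_left _ hk0)
      (Nat.Coprime.coprime_dvd_left (Nat.gcd_dvd_left k _) hgcd)
      (fun n hn hle => le_antisymm (S.le_max' n hn) hle ▸ Nat.gcd_dvd_right k _),
    ← exists_dvd_sup_filter_iff hk (S.max'_mem hS) hmax
      fun n hn h => absurd (S.le_max' n hn) (not_le.mpr h)]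
  simp only [Finset.mem_image, Finset.mem_filter, Nat.mem_divisors]
  constructor
  · rintro ⟨e, hek, he, rfl⟩
    exact ⟨k / e, ⟨⟨Nat.div_dvd_of_dvd hek, hk0.ne'⟩, Nat.div_lt_self hk0 he⟩, by
      rw [Nat.div_div_self hek hk0.ne']⟩
  · rintro ⟨d, ⟨⟨hd, -⟩, hlt⟩, rfl⟩
    exact ⟨k / d, Nat.div_dvd_of_dvd hd, one_lt_div d hd hlt, rfl⟩
end

section
/- Let k ≥ 2 and l ≥ 1 be integers, λ ∈ ℂ∖{0}, a₀ ∈ ℂ, and let b_l, …, b_{lk−1} ∈ ℂ; set Q(ζ) := Σ_{n=l}^{lk−1} b_n ζ^n. Define the maps g_γ, g : ℂ² → ℂ² by g_γ(z,w) := (z, w + 2πi) and g(z,w) := (λ z + a₀ + Q(e^{−w}), k w). For integers r ∈ ℤ and m ≥ 1 define τ_{r,m} : ℂ² → ℂ² by τ_{r,m}(z,w) := (z + Σ_{j=0}^{m−1} λ^{−j−1} Σ_{n=l}^{lk−1} b_n e^{−n k^j w} (1 − exp(−2πi r n / k^{m−j})), w + 2πi r / k^m). Then g^{∘m} ∘ τ_{r,m}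 = g_γ^{∘r} ∘ g^{∘m}, where g^{∘m} denotes the m-fold iterate of g and g_γ^{∘r} the r-fold iterate of g_γ (i.e. translation of the second coordinate by 2πir). In particular, whenever g is invertible on the domain considered, τ_{r,m} = g^{−m} ∘ g_γ^{r} ∘ g^{m}. -/
open Complex

/-- Iterates of the affine skew product `(z, w) ↦ (c z + F w, d w)`. -/
theorem iterate_affine_skew_product {K : Type*} [CommSemiring K] (c d : K) (F : K → K) (m : ℕ)
    (p : K × K) :
    (fun q : K × K => (c * q.1 + F q.2, d * q.2))^[m] p =
      (c ^ m * p.1 + ∑ i ∈ Finset.range m, c ^ (m - 1 - i) * F (d ^ i * p.2), d ^ m * p.2) := by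
  induction m with
  | zero => simp
  | succ m ih =>
    rw [Function.iterate_succ_apply', ih]
    have h : ∑ i ∈ Finset.range m, c ^ (m - i) * F (d ^ i * p.2) =
        c * ∑ i ∈ Finset.range m, c ^ (m - 1 - i) * F (d ^ i * p.2) := by
      rw [Finset.mul_sum]
      refine Finset.sum_congr rfl fun i hi => ?_
      have hi' := Finset.mem_range.mp hi
      rw [← mul_assoc, ← pow_succ', show m - 1 - i + 1 = m - i by omega]
    ext
    · simp only [Nat.add_sub_cancel, Finset.sum_range_succ, h, Nat.sub_self, pow_zero, one_mul]
      ring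
    · simp only
      ring

/-- The commutation relation `g^{∘m} ∘ τ_{r,m} = g_γ^{∘r} ∘ g^{∘m}` for the automorphisms
`g_γ(z,w) = (z, w + 2πi)`, `g(z,w) = (λz + a₀ + Q(e^{−w}), kw)` with
`Q(ζ) = Σ_{n=l}^{lk−1} b_n ζ^n`, and
`τ_{r,m}(z,w) = (z + Σ_{j=0}^{m−1} λ^{−j−1} Σ_{n=l}^{lk−1} b_n e^{−nk^jw}
(1 − exp(−2πirn/k^{m−j})), w + 2πir/k^m)`, where `g_γ^{∘r}` (`r ∈ ℤ`) is translation of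
the second coordinate by `2πir`. -/
theorem statement5 (k l : ℕ) (hk : 2 ≤ k) (hl : 1 ≤ l)
    (lam : ℂ) (hlam : lam ≠ 0) (a0 : ℂ) (b : ℕ → ℂ)
    (r : ℤ) (m : ℕ) (hm : 1 ≤ m)
    (g τ : ℂ × ℂ → ℂ × ℂ)
    (hg : g = fun p => (lam * p.1 + a0 +
      ∑ n ∈ Finset.Icc l (l * k - 1), b n * Complex.exp (-p.2) ^ n, (k : ℂ) * p.2))
    (hτ : τ = fun p => (p.1 + ∑ i ∈ Finset.range m, lam ^ (-(i : ℤ) - 1) *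
        ∑ n ∈ Finset.Icc l (l * k - 1), b n * Complex.exp (-(n : ℂ) * (k : ℂ) ^ i * p.2) *
          (1 - Complex.exp (-(2 * (Real.pi : ℂ) * Complex.I * (r : ℂ) * (n : ℂ)) /
            (k : ℂ) ^ (m - i))),
      p.2 + 2 * (Real.pi : ℂ) * Complex.I * (r : ℂ) / (k : ℂ) ^ m)) :
    g^[m] ∘ τ =
      (fun p : ℂ × ℂ => (p.1, p.2 + 2 * (Real.pi : ℂ) * Complex.I * (r : ℂ))) ∘ g^[m] := by
  have hk0 : (k : ℂ) ≠ 0 := Nat.cast_ne_zero.mpr (by omega)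
  let F : ℂ → ℂ := fun w => a0 + ∑ n ∈ Finset.Icc l (l * k - 1), b n * Complex.exp (-w) ^ n
  have hgF : g = fun p : ℂ × ℂ => (lam * p.1 + F p.2, (k : ℂ) * p.2) := by
    simp only [hg, F, add_assoc]
  have hshift : ∀ w : ℂ, ∀ i < m,
      (∑ n ∈ Finset.Icc l (l * k - 1), b n * Complex.exp (-(n : ℂ) * (k : ℂ) ^ i * w) *
          (1 - Complex.exp (-(2 * (Real.pi : ℂ) * Complex.I * (r : ℂ) * (n : ℂ)) /
            (k : ℂ) ^ (m - i)))) +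
        F ((k : ℂ) ^ i * (w + 2 * (Real.pi : ℂ) * Complex.I * (r : ℂ) / (k : ℂ) ^ m)) =
      F ((k : ℂ) ^ i * w) := by
    intro w i hi
    simp only [F]
    rw [add_left_comm, ← Finset.sum_add_distrib]
    congr 1
    refine Finset.sum_congr rfl fun n _ => ?_
    have hpow : (k : ℂ) ^ m = (k : ℂ) ^ i * (k : ℂ) ^ (m - i) := by
      rw [← pow_add, Nat.add_sub_cancel' hi.le]
    have hexp : Complex.exp (-((k : ℂ) ^ i *
          (w + 2 * (Real.pi : ℂ) * Complex.I * (r : ℂ) / (k : ℂ) ^ m))) ^ n =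
        Complex.exp (-(n : ℂ) * (k : ℂ) ^ i * w) *
          Complex.exp (-(2 * (Real.pi : ℂ) * Complex.I * (r : ℂ) * (n : ℂ)) /
            (k : ℂ) ^ (m - i)) := by
      rw [← Complex.exp_nat_mul, ← Complex.exp_add, hpow]
      congr 1
      field_simp
      ring
    have hexp' : Complex.exp (-((k : ℂ) ^ i * w)) ^ n =
        Complex.exp (-(n : ℂ) * (k : ℂ) ^ i * w) := by
      rw [← Complex.exp_nat_mul]
      congr 1
      ring
    rw [hexp, hexp']
    ring
  funext p
  simp only [Function.comp_apply, hgF, hτ, iterate_affine_skew_product]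
  ext
  · dsimp only
    rw [mul_add, add_assoc, Finset.mul_sum, ← Finset.sum_add_distrib]
    congr 1
    refine Finset.sum_congr rfl fun i hi => ?_
    have hi' := Finset.mem_range.mp hi
    have hlam_pow : lam ^ m * lam ^ (-(i : ℤ) - 1) = lam ^ (m - 1 - i) := by
      rw [← zpow_natCast, ← zpow_natCast, ← zpow_add₀ hlam]
      congr 1
      omega
    rw [← mul_assoc, hlam_pow, ← mul_add, hshift p.2 i hi']
  · dsimp only
    field_simp
end

section
/- Let k ≥ 2, s ≥ 1, j ≥ 1, N ≥ 0 be integers, λ ∈ ℂ∖{0}, c ∈ ℂ, P a complex polynomial, and ε ∈ ℂ with ε^{k−1} = 1. Define the maps ℂ² → ℂ²: φ(z,ζ) := (λ ζ^s z + P(ζ) + c ζ^N, ζ^k), φ̃(z,ζ) := (ε^s λ ζ^s z + ε^{−j} P(ε ζ) + ε^{N−j} c ζ^N, ζ^k), and χ(z,ζ) := (ε^j z, ε ζ). Then χ ∘ φ̃ = φ ∘ χ. In particular, since χ is a linear automorphism of ℂ², the germs φ and φ̃ are holomorphically conjugate. -/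
open Polynomial

/-- Easy direction of Favre's conjugacy criterion: for a `(k−1)`-th root of unity `ε`, the
linear map `χ(z,ζ) = (ε^j z, ε ζ)` intertwines the germs
`φ(z,ζ) = (λ ζ^s z + P(ζ) + c ζ^N, ζ^k)` and
`φ̃(z,ζ) = (ε^s λ ζ^s z + ε^{−j} P(εζ) + ε^{N−j} c ζ^N, ζ^k)`, i.e. `χ ∘ φ̃ = φ ∘ χ`. -/
theorem statement7 (k s j N : ℕ) (hk : 2 ≤ k) (hs : 1 ≤ s) (hj : 1 ≤ j)
    (lam : ℂ) (hlam : lam ≠ 0) (c : ℂ) (P : Polynomial ℂ)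
    (ε : ℂ) (hε : ε ^ (k - 1) = 1) :
    (fun p : ℂ × ℂ => (ε ^ j * p.1, ε * p.2)) ∘
        (fun p : ℂ × ℂ => (ε ^ s * lam * p.2 ^ s * p.1 + ε ^ (-(j : ℤ)) * P.eval (ε * p.2) +
          ε ^ ((N : ℤ) - (j : ℤ)) * c * p.2 ^ N, p.2 ^ k)) =
      (fun p : ℂ × ℂ => (lam * p.2 ^ s * p.1 + P.eval p.2 + c * p.2 ^ N, p.2 ^ k)) ∘
        (fun p : ℂ × ℂ => (ε ^ j * p.1, ε * p.2)) := by
  have hε0 : ε ≠ 0 := by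
    rintro rfl
    rw [zero_pow (by omega)] at hε
    exact zero_ne_one hε
  have hεk : ε ^ k = ε := by
    rw [← Nat.sub_add_cancel (by omega : 1 ≤ k), pow_succ, hε, one_mul]
  ext p
  · simp only [Function.comp_apply]
    rw [zpow_sub₀ hε0, zpow_neg, zpow_natCast, zpow_natCast, mul_pow, mul_pow]
    field_simp
  · simp only [Function.comp_apply]
    rw [mul_pow, hεk]
end

section
/- Let k ≥ 2 be an integer, d a positive divisor of k, λ ∈ ℂ∖{0}, a₀ ∈ ℂ, and Q a complex polynomial. Define the maps ℂ² → ℂ²: g_γ(z,w) := (z, w + 2πi), g(z,w) := (λ z + a₀ + Q(e^{−w}), k w), and f(z,w) := (z + λ^{−1}(Q(e^{−w}) − Q(e^{−w − 2πi d/k})), w + 2πi d/k). Then g ∘ f = g_γ^{∘d} ∘ g, and the (k/d)-fold iterate of f equals g_γ: f^{∘(k/d)} = g_γ. In particular, whenever g is invertible on the domain considered, (g^{−1} ∘ g_γ^{∘d} ∘ g)^{∘(k/d)} = g_γ. -/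
/-- Iterating a translation of the second coordinate coupled with the coboundary of `u`
in the first coordinate: the sum telescopes. -/
theorem iterate_skew_translation {A B : Type*} [AddCommGroup A] [AddCommGroup B]
    (u : B → A) (c : B) (n : ℕ) (p : A × B) :
    (fun q : A × B => (q.1 + (u q.2 - u (q.2 + c)), q.2 + c))^[n] p =
      (p.1 + (u p.2 - u (p.2 + n • c)), p.2 + n • c) := by
  induction n with
  | zero => simp
  | succ n ih =>
    rw [Function.iterate_succ_apply', ih]
    simp only [succ_nsmul, ← add_assoc]
    congr 1
    abel

/-- For a divisor `d` of `k`, with `g_γ(z,w) = (z, w + 2πi)`,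
`g(z,w) = (λz + a₀ + Q(e^{−w}), kw)` and
`f(z,w) = (z + λ⁻¹(Q(e^{−w}) − Q(e^{−w−2πid/k})), w + 2πid/k)`, one has
`g ∘ f = g_γ^{∘d} ∘ g` and `f^{∘(k/d)} = g_γ`. -/
theorem statement11 (k d : ℕ) (hk : 2 ≤ k) (hd : 0 < d) (hdvd : d ∣ k)
    (lam : ℂ) (hlam : lam ≠ 0) (a0 : ℂ) (Q : Polynomial ℂ)
    (gγ g f : ℂ × ℂ → ℂ × ℂ)
    (hgγ : gγ = fun p => (p.1, p.2 + 2 * (Real.pi : ℂ) * Complex.I))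
    (hg : g = fun p => (lam * p.1 + a0 + Q.eval (Complex.exp (-p.2)), (k : ℂ) * p.2))
    (hf : f = fun p => (p.1 + lam⁻¹ * (Q.eval (Complex.exp (-p.2)) -
        Q.eval (Complex.exp (-p.2 - 2 * (Real.pi : ℂ) * Complex.I * (d : ℂ) / (k : ℂ)))),
      p.2 + 2 * (Real.pi : ℂ) * Complex.I * (d : ℂ) / (k : ℂ))) :
    g ∘ f = gγ^[d] ∘ g ∧ f^[k / d] = gγ := by
  have hk0 : (k : ℂ) ≠ 0 := by exact_mod_cast (by omega : k ≠ 0)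
  have hd0 : (d : ℂ) ≠ 0 := by exact_mod_cast hd.ne'
  have hγ_iter (n : ℕ) (p : ℂ × ℂ) :
      gγ^[n] p = (p.1, p.2 + n * (2 * (Real.pi : ℂ) * Complex.I)) := by
    simpa [hgγ] using
      iterate_skew_translation (fun _ => (0 : ℂ)) (2 * (Real.pi : ℂ) * Complex.I) n p
  set c : ℂ := 2 * (Real.pi : ℂ) * Complex.I * (d : ℂ) / (k : ℂ) with hc
  constructor
  · funext p
    simp only [Function.comp_apply, hγ_iter, hg, hf, Prod.mk.injEq]
    constructor
    · rw [neg_add']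
      field_simp
      ring
    · rw [hc]
      field_simp
  · have hf_skew : f = fun q : ℂ × ℂ =>
        (q.1 + (lam⁻¹ * Q.eval (Complex.exp (-q.2)) -
          lam⁻¹ * Q.eval (Complex.exp (-(q.2 + c)))), q.2 + c) := by
      rw [hf]
      funext q
      rw [neg_add', mul_sub]
    have hperiod : (k / d) • c = 2 * (Real.pi : ℂ) * Complex.I := by
      rw [nsmul_eq_mul, Nat.cast_div hdvd hd0, hc]
      field_simp
    funext p
    rw [hf_skew,
      iterate_skew_translation (fun w => lam⁻¹ * Q.eval (Complex.exp (-w))) c (k / d) p,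
      hperiod, hgγ, neg_add', Complex.exp_periodic.sub_eq, sub_self, add_zero]
end

section
/- Let k ≥ 2 and t ≥ 1 be integers, and let n₁ > n₂ > … > n_t ≥ 1 be integers with n₁ < k·n_t. Set j₀ := k and j_α := gcd(j_{α−1}, n_α) for 1 ≤ α ≤ t, and assume j_α < j_{α−1} for all 1 ≤ α ≤ t and j_t = 1. Fix p ∈ {1, …, t} and define ñ_i := k n_{p+i} / j_p for 1 ≤ i ≤ t−p and ñ_{t−p+i} := n_i / j_p for 1 ≤ i ≤ p. Then: (a) all ñ_i are positive integers; (b) ñ₁ > ñ₂ > … > ñ_t ≥ 1 and ñ₁ < k·ñ_t; (c) setting j̃₀ := k and j̃_α := gcd(j̃_{α−1}, ñ_α), one has j̃_i = (k/j_p)·j_{p+i} for 1 ≤ i ≤ t−p and j̃_{t−p+i} = j_i / j_p for 1 ≤ i ≤ p; in particular j̃_α < j̃_{α−1} for all 1 ≤ α ≤ t and j̃_t = 1, so (ñ₁, …, ñ_t) again satisfies all the hypotheses, with the same length t. -/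
/-- If each term of a sequence divides its predecessor up to index `t`, then later terms
divide earlier ones. -/
theorem dvd_of_le_of_dvd_pred {t : ℕ} {j : ℕ → ℕ}
    (h : ∀ α : ℕ, 1 ≤ α → α ≤ t → j α ∣ j (α - 1)) {a b : ℕ} (hab : a ≤ b) (hb : b ≤ t) :
    j b ∣ j a := by
  induction b, hab using Nat.le_induction with
  | base => exact dvd_rfl
  | succ b _ ih => exact (h (b + 1) (by omega) hb).trans (ih (by omega))

/-- Transformation of the decreasing type `(n₁, …, n_t)` (with gcd sequence
`j₀ = k, j_α = gcd(j_{α−1}, n_α)`, `j_α < j_{α−1}`, `j_t = 1`, `n₁ < k·n_t`) under the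
cyclic move determined by `p`: with `ñᵢ := k n_{p+i}/j_p` for `1 ≤ i ≤ t−p` and
`ñ_{t−p+i} := nᵢ/j_p` for `1 ≤ i ≤ p`, all `ñᵢ` are positive integers, strictly
decreasing with `ñ₁ < k·ñ_t`, and the new gcd sequence satisfies
`j̃ᵢ = (k/j_p)·j_{p+i}` for `1 ≤ i ≤ t−p` and `j̃_{t−p+i} = jᵢ/j_p` for `1 ≤ i ≤ p`; in
particular `j̃_α < j̃_{α−1}` for all `α` and `j̃_t = 1`, so `(ñ₁, …, ñ_t)` again satisfies
all the hypotheses, with the same length `t`. -/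
theorem statement12 (k t : ℕ) (hk : 2 ≤ k) (ht : 1 ≤ t)
    (n : ℕ → ℕ)
    (hpos : 1 ≤ n t)
    (hdec : ∀ α : ℕ, 1 ≤ α → α < t → n (α + 1) < n α)
    (hbound : n 1 < k * n t)
    (j : ℕ → ℕ) (hj0 : j 0 = k)
    (hjrec : ∀ α : ℕ, 1 ≤ α → α ≤ t → j α = Nat.gcd (j (α - 1)) (n α))
    (hjdec : ∀ α : ℕ, 1 ≤ α → α ≤ t → j α < j (α - 1))
    (hjt : j t = 1)
    (p : ℕ) (hp1 : 1 ≤ p) (hpt : p ≤ t)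
    (ntil : ℕ → ℕ)
    (hntilA : ∀ i : ℕ, 1 ≤ i → i ≤ t - p → ntil i = k * n (p + i) / j p)
    (hntilB : ∀ i : ℕ, 1 ≤ i → i ≤ p → ntil (t - p + i) = n i / j p) :
    ((∀ i : ℕ, 1 ≤ i → i ≤ t - p → j p ∣ k * n (p + i)) ∧
      (∀ i : ℕ, 1 ≤ i → i ≤ p → j p ∣ n i)) ∧
    ((∀ i : ℕ, 1 ≤ i → i ≤ t → 1 ≤ ntil i) ∧
      (∀ α : ℕ, 1 ≤ α → α < t → ntil (α + 1) < ntil α) ∧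
      ntil 1 < k * ntil t) ∧
    (∀ jt : ℕ → ℕ, jt 0 = k →
      (∀ α : ℕ, 1 ≤ α → α ≤ t → jt α = Nat.gcd (jt (α - 1)) (ntil α)) →
      (∀ i : ℕ, 1 ≤ i → i ≤ t - p → jt i = k / j p * j (p + i)) ∧
      (∀ i : ℕ, 1 ≤ i → i ≤ p → jt (t - p + i) = j i / j p) ∧
      (∀ α : ℕ, 1 ≤ α → α ≤ t → jt α < jt (α - 1)) ∧
      jt t = 1) := by
  obtain ⟨q, rfl⟩ : ∃ q, t = q + p := ⟨t - p, by omega⟩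
  simp only [Nat.add_sub_cancel] at *
  have hjdvd {a b : ℕ} (hab : a ≤ b) (hb : b ≤ q + p) : j b ∣ j a :=
    dvd_of_le_of_dvd_pred (fun α h₁ h₂ => hjrec α h₁ h₂ ▸ Nat.gcd_dvd_left _ _) hab hb
  have hnt (i : ℕ) (h₁ : 1 ≤ i) (hi : i ≤ q + p) : n (q + p) ≤ n i := by
    induction hi using Nat.decreasingInduction with
    | self => exact le_rfl
    | of_succ i hi ih => exact (ih (by omega)).trans (hdec i h₁ (by omega)).le
  obtain ⟨d, hd⟩ : j p ∣ k := hj0 ▸ hjdvd (Nat.zero_le p) hpt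
  have hg : 0 < j p := Nat.pos_of_ne_zero fun h => by simp [h] at hd; omega
  have hd0 : 0 < d := Nat.pos_of_ne_zero fun h => by simp [h] at hd; omega
  have hkd : k / j p = d := by rw [hd, Nat.mul_div_cancel_left _ hg]
  have hdvdA (i : ℕ) : j p ∣ k * n (p + i) := (Dvd.intro _ hd.symm).mul_right _
  have hdvdB (i : ℕ) (h₁ : 1 ≤ i) (h₂ : i ≤ p) : j p ∣ n i :=
    (hjdvd h₂ hpt).trans (hjrec i h₁ (by omega) ▸ Nat.gcd_dvd_right _ _)
  have hA (i : ℕ) (h₁ : 1 ≤ i) (h₂ : i ≤ q) : ntil i = d * n (p + i) := by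
    rw [hntilA i h₁ h₂, hd, mul_assoc, Nat.mul_div_cancel_left _ hg]
  have hB (i : ℕ) (h₁ : 1 ≤ i) (h₂ : i ≤ p) : j p * ntil (q + i) = n i := by
    rw [hntilB i h₁ h₂, Nat.mul_div_cancel' (hdvdB i h₁ h₂)]
  refine ⟨⟨fun i _ _ => hdvdA i, hdvdB⟩, ⟨?_, ?_, ?_⟩, ?_⟩
  · intro i h₁ h₂
    rcases le_or_gt i q with h | h
    · rw [hA i h₁ h]
      exact Nat.mul_pos hd0 (hpos.trans (hnt _ (by omega) (by omega)))
    · obtain ⟨i, rfl⟩ := Nat.exists_eq_add_of_le h.le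
      refine Nat.pos_of_mul_pos_left (a := j p) ?_
      rw [hB i (by omega) (by omega)]
      exact hpos.trans (hnt _ (by omega) (by omega))
  · intro i h₁ h₂
    rcases lt_trichotomy i q with h | rfl | h
    · rw [hA i h₁ h.le, hA (i + 1) (by omega) h]
      exact Nat.mul_lt_mul_of_pos_left (hdec (p + i) (by omega) (by omega)) hd0
    · refine Nat.lt_of_mul_lt_mul_left (a := j p) ?_
      rw [hB 1 le_rfl hp1, hA i h₁ le_rfl, ← mul_assoc, ← hd, add_comm p]
      exact hbound
    · obtain ⟨i, rfl⟩ := Nat.exists_eq_add_of_le h.le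
      refine Nat.lt_of_mul_lt_mul_left (a := j p) ?_
      rw [add_assoc, hB i (by omega) (by omega), hB (i + 1) (by omega) (by omega)]
      exact hdec i (by omega) (by omega)
  · rcases Nat.eq_zero_or_pos q with rfl | hq
    · refine Nat.lt_of_mul_lt_mul_left (a := j p) ?_
      have h := hB 1 le_rfl hp1
      rw [zero_add] at h
      rw [h, mul_left_comm, hB p hp1 le_rfl]
      simpa using hbound
    · rw [hA 1 le_rfl hq, hd, mul_comm (j p), mul_assoc, hB p hp1 le_rfl]
      exact Nat.mul_lt_mul_of_pos_left (hdec p hp1 (by omega)) hd0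
  · intro jt hjt0 hjtrec
    have hJA (i : ℕ) (hi : i ≤ q) : jt i = d * j (p + i) := by
      induction i with
      | zero => rw [hjt0, hd, add_zero, mul_comm]
      | succ i ih =>
        rw [hjtrec (i + 1) (by omega) (by omega), Nat.add_sub_cancel, ih (by omega),
          hA (i + 1) (by omega) hi, Nat.gcd_mul_left, hjrec (p + (i + 1)) (by omega) (by omega)]
        rfl
    have hJB (i : ℕ) (hi : i ≤ p) : j p * jt (q + i) = j i := by
      induction i with
      | zero => rw [add_zero, hJA q le_rfl, add_comm p, hjt, mul_one, hj0, hd]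
      | succ i ih =>
        rw [hjtrec (q + (i + 1)) (by omega) (by omega), ← Nat.gcd_mul_left,
          hB (i + 1) (by omega) hi, hjrec (i + 1) (by omega) (by omega), ← add_assoc,
          Nat.add_sub_cancel, Nat.add_sub_cancel, ih (by omega)]
    refine ⟨fun i _ h₂ => by rw [hkd, hJA i h₂], fun i _ h₂ => ?_, fun i h₁ h₂ => ?_, ?_⟩
    · rw [← hJB i h₂, Nat.mul_div_cancel_left _ hg]
    · rcases le_or_gt i q with h | h
      · rw [hJA i h, hJA (i - 1) (by omega), ← Nat.add_sub_assoc h₁]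
        exact Nat.mul_lt_mul_of_pos_left (hjdec (p + i) (by omega) (by omega)) hd0
      · obtain ⟨i, rfl⟩ := Nat.exists_eq_add_of_le h.le
        refine Nat.lt_of_mul_lt_mul_left (a := j p) ?_
        rw [Nat.add_sub_assoc (by omega), hJB i (by omega), hJB (i - 1) (by omega)]
        exact hjdec i (by omega) (by omega)
    · exact Nat.eq_of_mul_eq_mul_left hg (by rw [hJB p le_rfl, mul_one])
end

section
/- Let k, d, a, n be positive integers with k ∣ d·a. Then gcd(d·n, k) = gcd(d·gcd(a, n), k). -/
/-- The gcd identity behind the computation of the transformed type: if `k ∣ d·a` then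
`gcd(d·n, k) = gcd(d·gcd(a,n), k)`. -/
theorem statement13 (k d a n : ℕ) (hk : 0 < k) (hd : 0 < d) (ha : 0 < a) (hn : 0 < n)
    (h : k ∣ d * a) : Nat.gcd (d * n) k = Nat.gcd (d * Nat.gcd a n) k := by
  rw [← Nat.gcd_mul_left, Nat.gcd_comm (d * a), Nat.gcd_assoc, Nat.gcd_eq_right h]
end

section
/- Let k ≥ 2 and q ≥ 1 be integers with q ∣ k−1, let λ ∈ ℂ∖{0}, let S be a finite nonempty set of positive integers, let b_m ∈ ℂ for m ∈ S, set Q(ζ) := Σ_{m∈S} b_m ζ^m, and let σ be an integer such that q ∣ σ − m for every m ∈ S with b_m ≠ 0. Define the maps ℂ² → ℂ²: g_γ(z,w) := (z, w + 2πi), g(z,w) := (λ z + Q(e^{−w}), k w), and φ(z,w) := (e^{2πiσ/q} z, w − 2πi/q). Then φ ∘ g_γ = g_γ ∘ φ and φ ∘ g = g_γ^{∘((k−1)/q)} ∘ g ∘ φ, where g_γ^{∘((k−1)/q)} denotes the ((k−1)/q)-fold iterate of g_γ (translation of the second coordinate by 2πi(k−1)/q). -/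
/-- Translating the second coordinate by `c`, iterated `n` times, is translation by `n * c`. -/
theorem iterate_snd_add {α R : Type*} [Semiring R] (c : R) (n : ℕ) (p : α × R) :
    (fun p : α × R => (p.1, p.2 + c))^[n] p = (p.1, p.2 + n * c) := by
  induction n with
  | zero => simp
  | succ n ih =>
    rw [Function.iterate_succ_apply', ih]
    simp [add_mul, add_assoc]

/-- The `q`-th root of unity `e^{2πis/q}` depends only on the residue class of `s` modulo `q`. -/
theorem exp_two_pi_I_mul_div_congr {q : ℕ} (hq : q ≠ 0) {s t : ℤ} (h : (q : ℤ) ∣ s - t) :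
    Complex.exp (2 * (Real.pi : ℂ) * Complex.I * s / q) =
      Complex.exp (2 * (Real.pi : ℂ) * Complex.I * t / q) := by
  obtain ⟨c, hc⟩ := h
  have hq' : (q : ℂ) ≠ 0 := Nat.cast_ne_zero.mpr hq
  have hs : (s : ℂ) = t + q * c := by exact_mod_cast (by linarith : s = t + q * c)
  rw [Complex.exp_eq_exp_iff_exists_int]
  refine ⟨c, ?_⟩
  rw [hs]
  field_simp

/-- Property `(I_q)`: if `q ∣ k−1` and `q` divides `σ − m` for every active exponent `m`
of `Q`, then `φ(z,w) = (e^{2πiσ/q} z, w − 2πi/q)` normalizes the group generated by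
`g_γ(z,w) = (z, w + 2πi)` and `g(z,w) = (λz + Q(e^{−w}), kw)`:
`φ ∘ g_γ = g_γ ∘ φ` and `φ ∘ g = g_γ^{∘((k−1)/q)} ∘ g ∘ φ`. -/
theorem statement14 (k q : ℕ) (hk : 2 ≤ k) (hq : 1 ≤ q) (hqk : q ∣ k - 1)
    (lam : ℂ) (hlam : lam ≠ 0)
    (S : Finset ℕ) (hS : S.Nonempty) (hSpos : ∀ m ∈ S, 0 < m)
    (b : ℕ → ℂ) (σ : ℤ)
    (hσ : ∀ m ∈ S, b m ≠ 0 → (q : ℤ) ∣ σ - (m : ℤ))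
    (gγ g φ : ℂ × ℂ → ℂ × ℂ)
    (hgγ : gγ = fun p => (p.1, p.2 + 2 * (Real.pi : ℂ) * Complex.I))
    (hg : g = fun p => (lam * p.1 + ∑ m ∈ S, b m * Complex.exp (-p.2) ^ m, (k : ℂ) * p.2))
    (hφ : φ = fun p => (Complex.exp (2 * (Real.pi : ℂ) * Complex.I * (σ : ℂ) / (q : ℂ)) * p.1,
      p.2 - 2 * (Real.pi : ℂ) * Complex.I / (q : ℂ))) :
    φ ∘ gγ = gγ ∘ φ ∧ φ ∘ g = gγ^[(k - 1) / q] ∘ (g ∘ φ) := by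
  have hq0 : q ≠ 0 := by omega
  have hqC : (q : ℂ) ≠ 0 := Nat.cast_ne_zero.mpr hq0
  subst hgγ hg hφ
  refine ⟨funext fun p => Prod.ext rfl ?_, funext fun p => ?_⟩
  · simp only [Function.comp_apply]
    ring
  simp only [Function.comp_apply, iterate_snd_add]
  refine Prod.ext ?_ ?_
  · simp only [mul_add, Finset.mul_sum]
    congr 1
    · ring
    refine Finset.sum_congr rfl fun m hm => ?_
    by_cases hb : b m = 0
    · simp [hb]
    rw [exp_two_pi_I_mul_div_congr hq0 (hσ m hm hb), mul_left_comm]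
    congr 1
    rw [← Complex.exp_nat_mul, ← Complex.exp_nat_mul, ← Complex.exp_add]
    congr 1
    push_cast
    ring
  · simp only
    rw [Nat.cast_div hqk hqC, Nat.cast_sub (by omega)]
    field_simp
    push_cast
    ring
end

section
/- Let k ≥ 2 and q ≥ 1 be integers with q ∣ k−1, and let j', s' be integers with 0 < j' < k, j' ≤ s', and (k−1) ∣ q·s'. Set r := ⌊q·j'/k⌋, s := q·s' − r(k−1), and j := q·j' − r·k. Then: (a) 0 < j < k, j ≤ s, q ∣ s, and (k−1) ∣ s. Moreover, (b) for any λ ∈ ℂ∖{0}, any complex numbers c'_m (j' ≤ m ≤ s'), and any ε ∈ ℂ with ε^q = 1, setting P(ζ) := Σ_{m=j'}^{s'} c'_m ζ^{q·m − r·k}, φ(z,ζ) := (λ ζ^s z + P(ζ), ζ^k), and χ(z,ζ) := (ε^{−r} z, ε ζ), one has χ ∘ φ = φ ∘ χ as maps ℂ² → ℂ². -/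
/-- The construction of Remark 4.3: from data `(k, q, j', s')` with `q ∣ k−1`,
`0 < j' < k`, `j' ≤ s'`, `(k−1) ∣ qs'`, setting `r := ⌊qj'/k⌋`, `s := qs' − r(k−1)` and
`j := qj' − rk`, one has (a) `0 < j < k`, `j ≤ s`, `q ∣ s`, `(k−1) ∣ s`; and (b) for any
`λ ≠ 0`, any coefficients `c'_m` and any `ε` with `ε^q = 1`, the germ
`φ(z,ζ) = (λ ζ^s z + Σ_{m=j'}^{s'} c'_m ζ^{qm−rk}, ζ^k)` commutes with
`χ(z,ζ) = (ε^{−r} z, ε ζ)`. -/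
theorem statement15 (k q j' s' : ℕ) (hk : 2 ≤ k) (hq : 1 ≤ q) (hqk : q ∣ k - 1)
    (hj'pos : 0 < j') (hj'k : j' < k) (hj's' : j' ≤ s') (hdvd : (k - 1) ∣ q * s')
    (r s j : ℕ) (hr : r = q * j' / k) (hs : s = q * s' - r * (k - 1))
    (hj : j = q * j' - r * k) :
    (0 < j ∧ j < k ∧ j ≤ s ∧ q ∣ s ∧ (k - 1) ∣ s) ∧
    ∀ lam : ℂ, lam ≠ 0 → ∀ (c' : ℕ → ℂ) (ε : ℂ), ε ^ q = 1 →
      (fun p : ℂ × ℂ => (ε ^ (-(r : ℤ)) * p.1, ε * p.2)) ∘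
          (fun p : ℂ × ℂ => (lam * p.2 ^ s * p.1 +
            ∑ m ∈ Finset.Icc j' s', c' m * p.2 ^ (q * m - r * k), p.2 ^ k)) =
        (fun p : ℂ × ℂ => (lam * p.2 ^ s * p.1 +
            ∑ m ∈ Finset.Icc j' s', c' m * p.2 ^ (q * m - r * k), p.2 ^ k)) ∘
          (fun p : ℂ × ℂ => (ε ^ (-(r : ℤ)) * p.1, ε * p.2)) := by
  have hkk : r * k = r * (k - 1) + r := by
    obtain ⟨n, rfl⟩ : ∃ n, k = n + 1 := ⟨k - 1, by omega⟩
    simp [mul_add]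
  have hcop : Nat.Coprime k q := by
    refine Nat.Coprime.coprime_dvd_right hqk ?_
    exact (Nat.coprime_self_sub_right (by omega)).mpr (Nat.coprime_one_right k)
  have hjmod : j = q * j' % k := by
    rw [hj, hr, Nat.mod_eq_sub_div_mul]
  have hle : ∀ m, j' ≤ m → r * k ≤ q * m := fun m hm =>
    calc r * k ≤ q * j' := hr ▸ Nat.div_mul_le_self _ _
      _ ≤ q * m := Nat.mul_le_mul_left q hm
  have hjpos : 0 < j := by
    rw [hjmod, Nat.pos_iff_ne_zero]
    intro h
    have hdvd_j' : k ∣ j' := hcop.dvd_of_dvd_mul_left (Nat.dvd_of_mod_eq_zero h)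
    exact absurd (Nat.le_of_dvd hj'pos hdvd_j') (by omega)
  have hqs : q ∣ s := by
    rw [hs]
    exact Nat.dvd_sub (Dvd.intro _ rfl) (hqk.mul_left r)
  refine ⟨⟨hjpos, ?_, ?_, hqs, ?_⟩, ?_⟩
  · rw [hjmod]
    exact Nat.mod_lt _ (by omega)
  · have := Nat.mul_le_mul_left q hj's'
    omega
  · rw [hs]
    exact Nat.dvd_sub hdvd (Dvd.intro_left r rfl)
  · intro lam _ c' ε hε
    have hε0 : ε ≠ 0 := by
      rintro rfl
      simp [Nat.ne_of_gt hq] at hε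
    have hpow : ∀ n, q ∣ n → ε ^ n = 1 := by
      rintro _ ⟨d, rfl⟩
      rw [pow_mul, hε, one_pow]
    have hexp : ∀ m, j' ≤ m → ε ^ (q * m - r * k) = ε ^ (-(r : ℤ)) := by
      intro m hm
      rw [zpow_neg, zpow_natCast]
      refine eq_inv_of_mul_eq_one_left ?_
      rw [← pow_add]
      apply hpow
      have h : q * m - r * k + r = q * m - r * (k - 1) := by
        have := hle m hm
        omega
      rw [h]
      exact Nat.dvd_sub (Dvd.intro _ rfl) (hqk.mul_left r)
    have hεk : ε ^ k = ε := by
      have h : k = k - 1 + 1 := by omega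
      rw [h, pow_succ, hpow _ hqk, one_mul]
    funext ⟨z, w⟩
    simp only [Function.comp_apply, mul_pow, hεk, hpow s hqs, mul_add, Finset.mul_sum]
    congr 2
    · ring
    · refine Finset.sum_congr rfl fun m hm => ?_
      rw [hexp m (Finset.mem_Icc.mp hm).1]
      ring
end

section
/- Let k₁, k₂ ≥ 1 and s₁ ≥ 0 be integers, and let S₁, S₂ be finite nonempty sets of positive integers with gcd({k₁} ∪ S₁) = 1 and gcd({k₂} ∪ S₂) = 1. Then gcd({k₁k₂} ∪ {k₂·m : m ∈ S₁} ∪ {s₁k₂ + m : m ∈ S₂}) = 1. -/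
/-- The gcd condition in the pure normal form is preserved under composition of germs:
if `gcd({k₁} ∪ S₁) = 1` and `gcd({k₂} ∪ S₂) = 1`, then
`gcd({k₁k₂} ∪ {k₂m : m ∈ S₁} ∪ {s₁k₂ + m : m ∈ S₂}) = 1`. -/
theorem statement16 (k1 k2 s1 : ℕ) (hk1 : 1 ≤ k1) (hk2 : 1 ≤ k2)
    (S1 S2 : Finset ℕ) (h1ne : S1.Nonempty) (h2ne : S2.Nonempty)
    (h1pos : ∀ m ∈ S1, 0 < m) (h2pos : ∀ m ∈ S2, 0 < m)
    (hg1 : Nat.gcd k1 (S1.gcd id) = 1) (hg2 : Nat.gcd k2 (S2.gcd id) = 1) :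
    Nat.gcd (k1 * k2)
      ((S1.image (fun m => k2 * m) ∪ S2.image (fun m => s1 * k2 + m)).gcd id) = 1 := by
  set d := Nat.gcd (k1 * k2)
    ((S1.image (fun m => k2 * m) ∪ S2.image (fun m => s1 * k2 + m)).gcd id)
  have hdvd : ∀ n ∈ S1.image (fun m => k2 * m) ∪ S2.image (fun m => s1 * k2 + m), d ∣ n :=
    fun n hn => (Nat.gcd_dvd_right _ _).trans (Finset.gcd_dvd (f := id) hn)
  have hS1 : d ∣ k2 * S1.gcd id := by
    have h : d ∣ S1.gcd (fun m => k2 * id m) := Finset.dvd_gcd fun m hm =>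
      hdvd _ (Finset.mem_union_left _ (Finset.mem_image_of_mem _ hm))
    rwa [Finset.gcd_mul_left, normalize_eq] at h
  have hdk2 : d ∣ k2 := by
    have h : d ∣ Nat.gcd (k2 * k1) (k2 * S1.gcd id) :=
      Nat.dvd_gcd (mul_comm k1 k2 ▸ Nat.gcd_dvd_left _ _) hS1
    rwa [Nat.gcd_mul_left, hg1, mul_one] at h
  have hS2 : d ∣ S2.gcd id := Finset.dvd_gcd fun m hm =>
    (Nat.dvd_add_right (hdk2.mul_left s1)).mp
      (hdvd _ (Finset.mem_union_right _ (Finset.mem_image_of_mem _ hm)))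
  exact Nat.dvd_one.mp (hg2 ▸ Nat.dvd_gcd hdk2 hS2)
end

section
/- Let k ≥ 2 be an integer and S a finite nonempty set of positive integers with gcd({k} ∪ S) = 1, and let (m₁, …, m_t) be the type of S with respect to k, with associated gcd sequence i₁ > i₂ > … > i_t = 1. Let m be a positive integer with m > m₁ such that either m > m_t, or there is an index α ∈ {1, …, t−1} with m_α < m < m_{α+1} and i_α ∣ m. Then gcd({k} ∪ S ∪ {m}) = 1 and the type of S ∪ {m} with respect to k is again (m₁, …, m_t). -/
/-- `i_α = gcd(k, m₁, …, m_α)`, the gcd of `k` with the first `a` entries of the list `L`. -/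
def gcdPrefix (k : ℕ) (L : List ℕ) (a : ℕ) : ℕ := (L.take a).foldl Nat.gcd k

theorem typeAux_eq_cons {S : Finset ℕ} {fuel i p q : ℕ} (hi : 1 < i)
    (hq : IsLeast {x | x ∈ S ∧ p < x ∧ Nat.gcd i x < i} q) :
    typeAux S (fuel + 1) i p = q :: typeAux S fuel (Nat.gcd i q) q := by
  have h : (S.filter fun m => p < m ∧ Nat.gcd i m < i).Nonempty :=
    ⟨q, Finset.mem_filter.2 ⟨hq.1.1, hq.1.2⟩⟩
  have hmin : (S.filter fun m => p < m ∧ Nat.gcd i m < i).min' h = q :=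
    le_antisymm (Finset.min'_le _ _ (Finset.mem_filter.2 ⟨hq.1.1, hq.1.2⟩))
      (hq.2 (Finset.mem_filter.1 (Finset.min'_mem _ h)))
  simp only [typeAux, if_neg hi.not_ge, dif_pos h, hmin]

theorem lt_of_mem_typeAux {S : Finset ℕ} {fuel i p x : ℕ} (hx : x ∈ typeAux S fuel i p) :
    p < x := by
  induction fuel generalizing i p with
  | zero => simp [typeAux] at hx
  | succ fuel ih =>
    simp only [typeAux] at hx
    split_ifs at hx with hi h
    · simp at hx
    · have hp := (Finset.mem_filter.1 (Finset.min'_mem _ h)).2.1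
      rcases List.mem_cons.1 hx with rfl | hx
      · exact hp
      · exact hp.trans (ih hx)
    · simp at hx

theorem le_getD_cons_typeAux {S : Finset ℕ} {fuel i p a : ℕ}
    (ha : a < (p :: typeAux S fuel i p).length) :
    p ≤ (p :: typeAux S fuel i p).getD a 0 := by
  rw [List.getD_eq_getElem _ _ ha]
  rcases List.mem_cons.1 (List.getElem_mem ha) with h | h
  · exact h.ge
  · exact (lt_of_mem_typeAux h).le

/-- Elements not exceeding the previous entry are irrelevant for the recursion. -/
theorem typeAux_insert_of_le {S : Finset ℕ} {fuel i p m : ℕ} (hm : m ≤ p) :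
    typeAux (insert m S) fuel i p = typeAux S fuel i p := by
  induction fuel generalizing i p with
  | zero => rfl
  | succ fuel ih =>
    have hf : (insert m S).filter (fun x => p < x ∧ Nat.gcd i x < i) =
        S.filter fun x => p < x ∧ Nat.gcd i x < i := by
      rw [Finset.filter_insert, if_neg fun h => hm.not_gt h.1]
    simp only [typeAux, hf]
    split_ifs with hi h
    · rfl
    · rw [ih (hm.trans (Finset.mem_filter.1 (Finset.min'_mem _ h)).2.1.le)]
    · rfl

theorem typeAux_insert {S : Finset ℕ} {fuel i p m : ℕ}
    (hdvd : ∀ s ∈ S, s ≤ p → i ∣ s) (hgcd : Nat.gcd i (S.gcd id) = 1)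
    (hm : (p :: typeAux S fuel i p).getD (typeAux S fuel i p).length 0 < m ∨
      ∃ a : ℕ, a < (typeAux S fuel i p).length ∧
        (p :: typeAux S fuel i p).getD a 0 < m ∧ m < (typeAux S fuel i p).getD a 0 ∧
        gcdPrefix i (typeAux S fuel i p) a ∣ m) :
    typeAux (insert m S) fuel i p = typeAux S fuel i p := by
  induction fuel generalizing i p with
  | zero => rfl
  | succ fuel ih =>
    by_cases hi : i ≤ 1
    · simp [typeAux, hi]
    have hi' : 1 < i := not_le.1 hi
    have hdvd_of {s : ℕ} (h : ¬ Nat.gcd i s < i) : i ∣ s :=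
      Nat.gcd_eq_left_iff_dvd.1 (le_antisymm (Nat.gcd_le_left _ (by omega)) (not_lt.1 h))
    have hne : (S.filter fun x => p < x ∧ Nat.gcd i x < i).Nonempty := by
      by_contra hne
      rw [Finset.not_nonempty_iff_eq_empty, Finset.filter_eq_empty_iff] at hne
      have : i ∣ S.gcd id := Finset.dvd_gcd fun s hs => by
        by_cases hsp : s ≤ p
        · exact hdvd s hs hsp
        · exact hdvd_of fun h => hne hs ⟨not_le.1 hsp, h⟩
      rw [Nat.gcd_eq_left this] at hgcd
      omega
    obtain ⟨q, hq⟩ : ∃ q, IsLeast {x | x ∈ S ∧ p < x ∧ Nat.gcd i x < i} q :=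
      ⟨_, Finset.mem_filter.1 (Finset.min'_mem _ hne),
        fun x hx => Finset.min'_le _ _ (Finset.mem_filter.2 ⟨hx.1, hx.2⟩)⟩
    have hS := typeAux_eq_cons (fuel := fuel) hi' hq
    have hT (h : m < q → i ∣ m) : typeAux (insert m S) (fuel + 1) i p =
        q :: typeAux (insert m S) fuel (Nat.gcd i q) q := by
      refine typeAux_eq_cons hi' ⟨⟨Finset.mem_insert_of_mem hq.1.1, hq.1.2⟩, ?_⟩
      rintro x ⟨hx, hpx, hix⟩
      rcases Finset.mem_insert.1 hx with rfl | hx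
      · by_contra hlt
        rw [Nat.gcd_eq_left (h (not_le.1 hlt))] at hix
        exact lt_irrefl _ hix
      · exact hq.2 ⟨hx, hpx, hix⟩
    have hdvd' : ∀ s ∈ S, s ≤ q → Nat.gcd i q ∣ s := by
      intro s hs hsq
      by_cases hsp : s ≤ p
      · exact (Nat.gcd_dvd_left _ _).trans (hdvd s hs hsp)
      rcases hsq.eq_or_lt with rfl | hlt
      · exact Nat.gcd_dvd_right _ _
      · exact (Nat.gcd_dvd_left _ _).trans
          (hdvd_of fun h => hlt.not_ge (hq.2 ⟨hs, not_le.1 hsp, h⟩))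
    have hgcd' : Nat.gcd (Nat.gcd i q) (S.gcd id) = 1 :=
      Nat.Coprime.coprime_dvd_left (Nat.gcd_dvd_left _ _) hgcd
    rw [hS] at hm ⊢
    rcases hm with hm | ⟨a, ha, ham, hma, hgm⟩
    · rw [List.length_cons, List.getD_cons_succ] at hm
      have hqm : q < m := (le_getD_cons_typeAux (by simp)).trans_lt hm
      rw [hT fun h => absurd h hqm.not_gt, ih hdvd' hgcd' (Or.inl hm)]
    · cases a with
      | zero =>
        rw [hT fun _ => by simpa [gcdPrefix] using hgm,
          typeAux_insert_of_le (by simpa using hma.le)]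
      | succ a =>
        rw [List.getD_cons_succ] at ham hma
        have hqm : q < m :=
          (le_getD_cons_typeAux (by simp only [List.length_cons] at ha ⊢; omega)).trans_lt ham
        rw [hT fun h => absurd h hqm.not_gt,
          ih hdvd' hgcd' (Or.inr ⟨a, by simpa using ha, ham, hma, by
            simpa [gcdPrefix] using hgm⟩)]


/-- Adding to `S` an exponent `m > m₁` which is either larger than `m_t` or lies strictly
between `m_α` and `m_{α+1}` for some `α < t` and is divisible by `i_α` does not change the
type: `gcd({k} ∪ S ∪ {m}) = 1` and the type of `S ∪ {m}` with respect to `k` equals the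
type of `S`. -/
theorem statement17 (k : ℕ) (hk : 2 ≤ k) (S : Finset ℕ) (hS : S.Nonempty)
    (hpos : ∀ n ∈ S, 0 < n) (hgcd : Nat.gcd k (S.gcd id) = 1)
    (m : ℕ) (hm1 : S.min' hS < m)
    (hm : (theType k S).getD ((theType k S).length - 1) 0 < m ∨
      ∃ a : ℕ, a + 1 < (theType k S).length ∧
        (theType k S).getD a 0 < m ∧ m < (theType k S).getD (a + 1) 0 ∧
        gcdPrefix k (theType k S) (a + 1) ∣ m) :
    Nat.gcd k ((insert m S).gcd id) = 1 ∧ theType k (insert m S) = theType k S := by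
  have hmin : (insert m S).min' (Finset.insert_nonempty m S) = S.min' hS := by
    rw [Finset.min'_insert _ _ hS, min_eq_right hm1.le]
  have hcop : Nat.gcd (Nat.gcd k (S.min' hS)) (S.gcd id) = 1 :=
    Nat.Coprime.coprime_dvd_left (Nat.gcd_dvd_left _ _) hgcd
  refine ⟨Nat.Coprime.coprime_dvd_right (Finset.gcd_mono (Finset.subset_insert m S)) hgcd, ?_⟩
  simp only [theType, dif_pos hS, dif_pos (Finset.insert_nonempty m S), hmin] at hm ⊢
  rw [typeAux_insert (fun s hs hle => ?_) hcop ?_]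
  · simpa [gcdPrefix] using hm
  · rw [le_antisymm hle (Finset.min'_le _ _ hs)]
    exact Nat.gcd_dvd_right _ _
end
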